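/- Let R be a subring of ℂ which is finitely generated as a ring over ℤ, and let F ∈ R[x,y,z] be a cubic form such that the plane projective curve {F = 0} ⊆ ℙ²(ℂ) is smooth (the only common zero in ℂ³ of ∂F/∂x, ∂F/∂y, ∂F/∂z is the origin). Let G(y,z) = d·y³ + z³ for some nonzero d ∈ R, and assume there exist a, b, c ∈ R and T₀ ∈ SL(3,R) with (T₀·F)(x,y,z) = a·x³ + x²·(b·y + c·z) + G(y,z). Then the set of pairs (a',(b',c')) ∈ R × R² for which there exists T ∈ SL(3,R) with (T·F)(x,y,z) = a'·x³ + x²·(b'·y + c'·z) + G(y,z) is finite. -/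

import Mathlib

open MvPolynomial

noncomputable section

/-- The Hessian matrix of a multivariate polynomial `F`, evaluated at the point `x`. -/
def hess {m : ℕ} {R : Type*} [CommSemiring R] (F : MvPolynomial (Fin m) R)
    (x : Fin m → R) : Matrix (Fin m) (Fin m) R :=
  Matrix.of fun i j => eval x (pderiv i (pderiv j F))

/-- A polynomial is non-degenerate if the determinant of its Hessian is not
identically zero. -/
def nondeg {m : ℕ} {R : Type*} [CommRing R] (F : MvPolynomial (Fin m) R) : Prop :=
  ∃ x, (hess F x).det ≠ 0

/-- The substitution action of a matrix on a polynomial: `(T · F)(x) = F (T.mulVec x)`. -/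
def matAct {m : ℕ} {R : Type*} [CommSemiring R] (T : Matrix (Fin m) (Fin m) R)
    (F : MvPolynomial (Fin m) R) : MvPolynomial (Fin m) R :=
  bind₁ (fun i => ∑ j, C (T i j) * X j) F

/-- The projective hypersurface `{F = 0}` is smooth: the only common zero of the
partial derivatives of `F` is the origin. -/
def smoothHyp {m : ℕ} (F : MvPolynomial (Fin m) ℂ) : Prop :=
  ∀ x : Fin m → ℂ, (∀ i, eval x (pderiv i F) = 0) → x = 0

/-- The polynomial `a·x₀³ + x₀²·(∑ᵢ bᵢ xᵢ) + G(x₁, …, xₙ)`. -/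
def redPoly {m : ℕ} {R : Type*} [CommSemiring R] (a : R) (B : Fin m → R)
    (G : MvPolynomial (Fin m) R) : MvPolynomial (Fin (m + 1)) R :=
  C a * X 0 ^ 3 + X 0 ^ 2 * (∑ i, C (B i) * X i.succ) + rename Fin.succ G

/-- `(a, B, G)` is a reduced triple associated to `F`: `G` is a non-degenerate
cubic form and some `T ∈ SL(n+1, ℤ)` puts `F` in the reduced form `(a, B, G)`. -/
def IsReducedTriple {n : ℕ} (F : MvPolynomial (Fin (n + 1)) ℤ)
    (a : ℤ) (B : Fin n → ℤ) (G : MvPolynomial (Fin n) ℤ) : Prop :=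
  G.IsHomogeneous 3 ∧ nondeg G ∧
    ∃ T : Matrix (Fin (n + 1)) (Fin (n + 1)) ℤ, T.det = 1 ∧ matAct T F = redPoly a B G

/-- Equivalence of reduced triples over ℤ: `a = a'` and some `M ∈ SL(n, ℤ)`
carries `(B, G)` to `(B', G')`. -/
def TripleEquiv {n : ℕ} (a : ℤ) (B : Fin n → ℤ) (G : MvPolynomial (Fin n) ℤ)
    (a' : ℤ) (B' : Fin n → ℤ) (G' : MvPolynomial (Fin n) ℤ) : Prop :=
  a = a' ∧ ∃ M : Matrix (Fin n) (Fin n) ℤ, M.det = 1 ∧ B' = M.mulVec B ∧ G' = matAct M G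

/-- A `1`-separated finite subset of a ball of radius `ρ` in a finite-dimensional normed space
has at most `(2 * ρ + 1) ^ dim` elements. -/
theorem card_le_of_one_separated {E : Type*} [NormedAddCommGroup E] [NormedSpace ℝ E]
    [FiniteDimensional ℝ E] (ρ : ℕ) (s : Finset E) (hs : ∀ c ∈ s, ‖c‖ ≤ ρ)
    (h : ∀ c ∈ s, ∀ d ∈ s, c ≠ d → 1 ≤ ‖c - d‖) :
    s.card ≤ (2 * ρ + 1) ^ Module.finrank ℝ E := by
  borelize E
  let μ : MeasureTheory.Measure E := MeasureTheory.Measure.addHaar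
  have hr : (0 : ℝ) < ρ + 1 / 2 := by positivity
  have disj : Set.Pairwise (s : Set E) (Function.onFun Disjoint fun c => Metric.ball c (1 / 2)) := by
    rintro c hc d hd hcd
    apply Metric.ball_disjoint_ball
    rw [dist_eq_norm]
    linarith [h c hc d hd hcd]
  have sub : (⋃ c ∈ s, Metric.ball c (1 / 2)) ⊆ Metric.ball (0 : E) (ρ + 1 / 2) := by
    refine Set.iUnion₂_subset fun x hx => Metric.ball_subset_ball' ?_
    rw [dist_zero_right]
    linarith [hs x hx]
  have I : (s.card : ENNReal) * ENNReal.ofReal ((1 / 2) ^ Module.finrank ℝ E) *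
      μ (Metric.ball 0 1) ≤
      ENNReal.ofReal ((ρ + 1 / 2) ^ Module.finrank ℝ E) * μ (Metric.ball 0 1) := by
    calc
      _ = μ (⋃ c ∈ s, Metric.ball c (1 / 2)) := by
        rw [MeasureTheory.measure_biUnion_finset disj fun c _ => measurableSet_ball]
        simp only [μ.addHaar_ball_of_pos _ (half_pos (zero_lt_one' ℝ)), Finset.sum_const,
          nsmul_eq_mul, mul_assoc]
      _ ≤ μ (Metric.ball (0 : E) (ρ + 1 / 2)) := MeasureTheory.measure_mono sub
      _ = _ := by rw [μ.addHaar_ball_of_pos _ hr]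
  have J := (ENNReal.mul_le_mul_iff_left (Metric.measure_ball_pos μ _ zero_lt_one).ne'
    MeasureTheory.measure_ball_lt_top.ne).1 I
  have K := ENNReal.toReal_le_of_le_ofReal (pow_nonneg hr.le _) J
  rw [ENNReal.toReal_mul, ENNReal.toReal_natCast, ENNReal.toReal_ofReal (by positivity)] at K
  have e : (ρ + 1 / 2 : ℝ) = (2 * ρ + 1) * (1 / 2) := by ring
  rw [e, mul_pow] at K
  have := le_of_mul_le_mul_right K (by positivity)
  exact_mod_cast this

/-- A large family of points in a ball of a normed space of dimension at most `d` has a large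
subfamily of diameter less than `2`. -/
theorem exists_close_subfamily {E : Type*} [NormedAddCommGroup E] [NormedSpace ℝ E]
    [FiniteDimensional ℝ E] {d : ℕ} (hd : Module.finrank ℝ E ≤ d) (ρ k : ℕ) {α : Type*}
    (s : Finset α) (f : α → E) (hf : ∀ a ∈ s, ‖f a‖ ≤ ρ)
    (hk : (2 * ρ + 1) ^ d * k < s.card) :
    ∃ t ⊆ s, k < t.card ∧ ∀ a ∈ t, ∀ b ∈ t, ‖f a - f b‖ < 2 := by
  classical
  obtain ⟨T, hT, hmax⟩ := Finset.exists_max_image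
    ((s.image f).powerset.filter fun T => ∀ c ∈ T, ∀ d ∈ T, c ≠ d → 1 ≤ ‖c - d‖)
    Finset.card ⟨∅, by simp⟩
  simp only [Finset.mem_filter, Finset.mem_powerset] at hT hmax
  obtain ⟨hTs, hsep⟩ := hT
  have hTcard : T.card ≤ (2 * ρ + 1) ^ d := by
    refine (card_le_of_one_separated ρ T (fun c hc => ?_) hsep).trans
      (Nat.pow_le_pow_right (by omega) hd)
    obtain ⟨a, ha, rfl⟩ := Finset.mem_image.1 (hTs hc)
    exact hf a ha
  have hcov : ∀ a ∈ s, ∃ c ∈ T, ‖f a - c‖ < 1 := by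
    intro a ha
    by_contra! hcon
    have hnot : f a ∉ T := fun h => by simpa using (hcon _ h).trans_lt' zero_lt_one
    have := hmax (insert (f a) T) ⟨Finset.insert_subset (Finset.mem_image_of_mem f ha) hTs, by
      intro c hc d hd hcd
      rcases Finset.mem_insert.1 hc with rfl | hc <;> rcases Finset.mem_insert.1 hd with rfl | hd
      · exact absurd rfl hcd
      · exact hcon _ hd
      · rw [norm_sub_rev]; exact hcon _ hc
      · exact hsep c hc d hd hcd⟩
    rw [Finset.card_insert_of_notMem hnot] at this
    omega
  choose! g hgT hg using hcov
  obtain ⟨c, hc, hlt⟩ := Finset.exists_lt_card_fiber_of_mul_lt_card_of_maps_to hgT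
    ((Nat.mul_le_mul_right k hTcard).trans_lt hk)
  refine ⟨_, Finset.filter_subset _ s, hlt, fun a ha b hb => ?_⟩
  simp only [Finset.mem_filter] at ha hb
  have h1 := hg a ha.1
  have h2 := hg b hb.1
  rw [ha.2] at h1
  rw [hb.2, norm_sub_rev] at h2
  calc ‖f a - f b‖ = ‖(f a - c) + (c - f b)‖ := by congr 1; abel
    _ ≤ _ := norm_add_le _ _
    _ < 2 := by linarith

open Finset in
/-- The polynomial identity underlying the Padé approximations of `(1 - x)^k`. -/
theorem pade_identity {R : Type*} [CommRing R] (α β γ : ℕ) (x y : R) (hxy : x + y = 1) :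
    ∑ j ∈ range (α + β + γ + 2), ((Ring.choose ((α : ℤ) + γ - j) α *
        ((α + β + γ + 1).choose j : ℤ) * (-1) ^ j : ℤ) : R) * x ^ j =
      ∑ i ∈ range (α + 1), ((Ring.choose (-(β : ℤ) - 1) (α - i) *
        ((α + β + γ + 1).choose i : ℤ) : ℤ) : R) * y ^ (α + β + γ + 1 - i) := by
  set M := α + β + γ + 1 with hM
  have hy : y = -x + 1 := by rw [← hxy]; ring
  have hpow : ∀ i ∈ range (α + 1), y ^ (M - i) =
      ∑ j ∈ range (M + 1), ((M - i).choose j : R) * (-1) ^ j * x ^ j := by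
    intro i hi
    rw [hy, add_pow]
    have hsub : range (M - i + 1) ⊆ range (M + 1) := by
      apply range_subset_range.2; omega
    rw [← sum_subset hsub]
    · refine sum_congr rfl fun j _ => ?_
      rw [neg_pow]; simp; ring
    · intro j _ hj
      have : M - i < j := by simpa using hj
      simp [Nat.choose_eq_zero_of_lt this]
  symm
  rw [sum_congr rfl fun i hi => congrArg _ (hpow i hi)]
  simp only [mul_sum]
  rw [sum_comm]
  refine sum_congr rfl fun j hj => ?_
  have key : Ring.choose ((α : ℤ) + γ - j) α * (M.choose j : ℤ) =
      ∑ i ∈ range (α + 1), Ring.choose (-(β : ℤ) - 1) (α - i) * (M.choose i : ℤ) *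
        ((M - i).choose j : ℤ) := by
    have hj' : j ≤ M := by simpa [Nat.lt_succ_iff] using hj
    have e : (α : ℤ) + γ - j = ((M - j : ℕ) : ℤ) + (-(β : ℤ) - 1) := by
      rw [Nat.cast_sub hj', hM]; push_cast; ring
    rw [e, Ring.add_choose_eq _ (Commute.all _ _), Nat.sum_antidiagonal_eq_sum_range_succ_mk,
      sum_mul]
    refine sum_congr rfl fun i hi => ?_
    have h : (M.choose i * (M - i).choose j : ℤ) = M.choose j * (M - j).choose i := by
      norm_cast
      by_cases hij : i + j ≤ M
      · have h1 := Nat.choose_mul (n := M) (k := i + j) (s := i) (by omega)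
        have h2 := Nat.choose_mul (n := M) (k := i + j) (s := j) (by omega)
        rw [Nat.add_sub_cancel_left] at h1
        rw [Nat.add_sub_cancel] at h2
        rw [← h1, ← h2, Nat.choose_symm_add]
      · have hi' : i ≤ α := by simpa [Nat.lt_succ_iff] using hi
        rw [Nat.choose_eq_zero_of_lt (by omega : M - i < j),
          Nat.choose_eq_zero_of_lt (by omega : M - j < i), mul_zero, mul_zero]
    rw [Ring.choose_natCast]
    linear_combination -Ring.choose (-(β : ℤ) - 1) (α - i) * h
  rw [key]
  push_cast
  rw [sum_mul, sum_mul]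
  refine sum_congr rfl fun i hi => ?_
  ring

theorem ringChoose_neg_succ (m k : ℕ) :
    Ring.choose (-(m : ℤ) - 1) k = (-1) ^ k * ((m + k).choose k : ℤ) := by
  have h := Ring.choose_neg (m + 1 : ℤ) k
  have e : (m : ℤ) + 1 + k - 1 = ((m + k : ℕ) : ℤ) := by push_cast; ring
  have e2 : (-(m : ℤ) - 1) = -(m + 1) := by ring
  rw [e2, h]
  rw [e, Ring.choose_natCast, Int.negOnePow_def, Units.smul_def]
  simp

/-- Padé approximants, with explicit coefficients. -/
theorem pade_triple {R : Type*} [CommRing R] (α β γ : ℕ) (x y : R) (hxy : x + y = 1) :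
    (-∑ k ∈ Finset.range (β + 1), (((-1) ^ α * (k + α).choose α *
        ((α + β + γ + 1).choose (α + γ + 1 + k) : ℤ) * (-1) ^ (α + γ + 1 + k) : ℤ) : R) * x ^ k)
        * x ^ (α + γ + 1) +
      (∑ i ∈ Finset.range (α + 1), (((-1) ^ i * (β + i).choose i *
        ((α + β + γ + 1).choose (α - i) : ℤ) : ℤ) : R) * y ^ i) * y ^ (β + γ + 1) =
      ∑ j ∈ Finset.range (γ + 1), (((α + γ - j).choose α *
        ((α + β + γ + 1).choose j : ℤ) * (-1) ^ j : ℤ) : R) * x ^ j := by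
  have h := pade_identity α β γ x y hxy
  have e : α + β + γ + 2 = ((γ + 1) + α) + (β + 1) := by ring
  rw [e, Finset.sum_range_add, Finset.sum_range_add, Finset.sum_eq_zero
    (s := Finset.range α)] at h
  · rw [← Finset.sum_range_reflect (n := α + 1)] at h
    rw [neg_mul, neg_add_eq_iff_eq_add, Finset.sum_mul, Finset.sum_mul]
    rw [add_zero] at h
    refine Eq.trans ?_ (h.symm.trans ?_)
    · refine Finset.sum_congr rfl fun i hi => ?_
      have hi' : i ≤ α := by simpa [Nat.lt_succ_iff] using hi
      have e1 : α + 1 - 1 - i = α - i := by omega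
      have e2 : α - (α - i) = i := by omega
      have e3 : α + β + γ + 1 - (α - i) = i + (β + γ + 1) := by omega
      rw [e1, e2, e3, ringChoose_neg_succ, pow_add _ i, mul_assoc]
    · rw [add_comm]
      congr 1
      · refine Finset.sum_congr rfl fun k hk => ?_
        have e1 : (α : ℤ) + γ - ((γ + 1 + α + k : ℕ) : ℤ) = -(k : ℤ) - 1 := by push_cast; ring
        rw [e1, ringChoose_neg_succ, show γ + 1 + α + k = k + (α + γ + 1) by ring, pow_add x,
          ← mul_assoc, show k + (α + γ + 1) = α + γ + 1 + k by ring]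
      · refine Finset.sum_congr rfl fun k hk => ?_
        have hk' : k ≤ γ := by simpa [Nat.lt_succ_iff] using hk
        have e1 : (α : ℤ) + γ - (k : ℤ) = ((α + γ - k : ℕ) : ℤ) := by
          rw [Nat.cast_sub (by omega)]; push_cast; ring
        rw [e1, Ring.choose_natCast]
  · intro k hk
    have hk' : k < α := by simpa using hk
    have e1 : (α : ℤ) + γ - ((γ + 1 + k : ℕ) : ℤ) = ((α - 1 - k : ℕ) : ℤ) := by
      rw [Nat.cast_sub (by omega), Nat.cast_sub (by omega)]; push_cast; ring
    rw [e1, Ring.choose_natCast, Nat.choose_eq_zero_of_lt (by omega)]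
    simp

theorem natDegree_sum_range_C_mul_X_pow_le {R : Type*} [Semiring R] (f : ℕ → R) (n : ℕ) :
    (∑ k ∈ Finset.range (n + 1), Polynomial.C (f k) * Polynomial.X ^ k).natDegree ≤ n :=
  Polynomial.natDegree_sum_le_of_forall_le _ _ fun i hi =>
    (Polynomial.natDegree_C_mul_X_pow_le _ _).trans (by simpa [Nat.lt_succ_iff] using hi)

theorem coeff_sum_range_C_mul_X_pow {R : Type*} [Semiring R] (f : ℕ → R) (n k : ℕ) :
    (∑ k ∈ Finset.range n, Polynomial.C (f k) * Polynomial.X ^ k).coeff k =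
      if k < n then f k else 0 := by
  simp

open Polynomial in
/-- Padé approximants with small coefficients, as integral polynomials. -/
theorem exists_pade (α β γ : ℕ) : ∃ A B C : ℤ[X], A.natDegree ≤ β ∧ B.natDegree ≤ α ∧
    C.natDegree ≤ γ ∧ (∀ k, |A.coeff k| ≤ 4 ^ (α + β + γ + 1)) ∧
    (∀ k, |B.coeff k| ≤ 4 ^ (α + β + γ + 1)) ∧ (∀ k, |C.coeff k| ≤ 4 ^ (α + β + γ + 1)) ∧
    A.coeff 0 ≠ 0 ∧ C.coeff 0 ≠ 0 ∧
    A * Polynomial.X ^ (α + γ + 1) + B.comp (1 - Polynomial.X) * (1 - Polynomial.X) ^ (β + γ + 1) = C := by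
  set M := α + β + γ + 1 with hM
  have four : ∀ u v a b : ℕ, u ≤ M → v ≤ M → (u.choose a * v.choose b : ℤ) ≤ 4 ^ M := by
    intro u v a b hu hv
    have h1 := (Nat.choose_le_two_pow u a).trans (Nat.pow_le_pow_right (by omega) hu)
    have h2 := (Nat.choose_le_two_pow v b).trans (Nat.pow_le_pow_right (by omega) hv)
    have h3 := Nat.mul_le_mul h1 h2
    rw [← mul_pow] at h3
    exact_mod_cast h3
  refine ⟨∑ k ∈ Finset.range (β + 1), Polynomial.C (-((-1) ^ α * (k + α).choose α *
        (M.choose (α + γ + 1 + k) : ℤ) * (-1) ^ (α + γ + 1 + k))) * Polynomial.X ^ k,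
    ∑ i ∈ Finset.range (α + 1), Polynomial.C ((-1) ^ i * (β + i).choose i *
        (M.choose (α - i) : ℤ)) * Polynomial.X ^ i,
    ∑ j ∈ Finset.range (γ + 1), Polynomial.C ((α + γ - j).choose α *
        (M.choose j : ℤ) * (-1) ^ j) * Polynomial.X ^ j,
    natDegree_sum_range_C_mul_X_pow_le _ _, natDegree_sum_range_C_mul_X_pow_le _ _,
    natDegree_sum_range_C_mul_X_pow_le _ _, fun k => ?_, fun k => ?_, fun k => ?_, ?_, ?_, ?_⟩
  · rw [coeff_sum_range_C_mul_X_pow]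
    split_ifs with hk
    · simp only [abs_neg, abs_mul, abs_pow, abs_one, one_pow, one_mul, mul_one, Nat.abs_cast]
      exact four _ _ _ _ (by omega) le_rfl
    · simp
  · rw [coeff_sum_range_C_mul_X_pow]
    split_ifs with hk
    · simp only [abs_neg, abs_mul, abs_pow, abs_one, one_pow, one_mul, Nat.abs_cast]
      exact four _ _ _ _ (by omega) le_rfl
    · simp
  · rw [coeff_sum_range_C_mul_X_pow]
    split_ifs with hk
    · simp only [abs_neg, abs_mul, abs_pow, abs_one, one_pow, mul_one, Nat.abs_cast]
      exact four _ _ _ _ (by omega) le_rfl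
    · simp
  · rw [coeff_sum_range_C_mul_X_pow, if_pos (by omega)]
    have : M.choose (α + γ + 1) ≠ 0 := (Nat.choose_pos (by omega)).ne'
    simp [this]
  · rw [coeff_sum_range_C_mul_X_pow, if_pos (by omega)]
    have : (α + γ).choose α ≠ 0 := (Nat.choose_pos (by omega)).ne'
    simp [this]
  · have h := pade_triple α β γ (Polynomial.X : ℤ[X]) (1 - Polynomial.X) (by ring)
    rw [← hM] at h
    have hc : (∑ i ∈ Finset.range (α + 1), Polynomial.C ((-1) ^ i * (β + i).choose i *
        (M.choose (α - i) : ℤ)) * (Polynomial.X : ℤ[X]) ^ i).comp (1 - Polynomial.X) =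
        ∑ i ∈ Finset.range (α + 1), Polynomial.C ((-1) ^ i * (β + i).choose i *
        (M.choose (α - i) : ℤ)) * (1 - Polynomial.X : ℤ[X]) ^ i := by
      simp [Polynomial.sum_comp]
    rw [hc]
    simpa [Finset.sum_neg_distrib] using h

open Polynomial in
/-- Two independent Padé approximants. -/
theorem exists_pade_pair (n : ℕ) (hn : 1 ≤ n) : ∃ A B C : Fin 2 → ℤ[X],
    (∀ i, (A i).natDegree ≤ n ∧ (B i).natDegree ≤ n ∧ (C i).natDegree ≤ n) ∧
    (∀ i k, |(A i).coeff k| ≤ 64 ^ n ∧ |(B i).coeff k| ≤ 64 ^ n ∧ |(C i).coeff k| ≤ 64 ^ n) ∧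
    (∀ i, A i * Polynomial.X ^ (2 * n) + (B i).comp (1 - Polynomial.X) * (1 - Polynomial.X) ^ (2 * n) = C i) ∧
    ∃ c : ℤ, c ≠ 0 ∧ A 0 * C 1 - A 1 * C 0 = Polynomial.C c * (1 - Polynomial.X) ^ (2 * n) := by
  obtain ⟨A, B, C, hA, hB, hC, hA', hB', hC', hA0, hC0, h⟩ := exists_pade n n (n - 1)
  obtain ⟨A₂, B₂, C₂, hA₂, hB₂, hC₂, hA₂', hB₂', hC₂', hA₂0, hC₂0, h₂⟩ := exists_pade n (n - 1) n
  have e1 : n + n + (n - 1) + 1 = 3 * n := by omega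
  have e2 : n + (n - 1) + n + 1 = 3 * n := by omega
  have e3 : n + (n - 1) + 1 = 2 * n := by omega
  have e4 : n + n + 1 = 2 * n + 1 := by omega
  have e5 : n - 1 + n + 1 = 2 * n := by omega
  have e64 : (4 : ℤ) ^ (3 * n) = 64 ^ n := by rw [pow_mul]; norm_num
  rw [e1, e64] at hA' hB' hC'
  rw [e2, e64] at hA₂' hB₂' hC₂'
  rw [e3] at h
  rw [e4, e5] at h₂
  have h₂' : Polynomial.X * A₂ * Polynomial.X ^ (2 * n) + B₂.comp (1 - Polynomial.X) * (1 - Polynomial.X) ^ (2 * n) = C₂ := by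
    rw [← h₂]; ring
  have hXA : (Polynomial.X * A₂).natDegree ≤ n := by
    refine natDegree_mul_le.trans ?_
    rw [natDegree_X]; omega
  refine ⟨![A, Polynomial.X * A₂], ![B, B₂], ![C, C₂], ?_, ?_, ?_, ?_⟩
  · intro i; fin_cases i
    · exact ⟨hA, hB, hC.trans (by omega)⟩
    · exact ⟨hXA, hB₂, hC₂⟩
  · intro i k; fin_cases i
    · exact ⟨hA' k, hB' k, hC' k⟩
    · refine ⟨?_, hB₂' k, hC₂' k⟩
      cases k with
      | zero => simp
      | succ k => simpa using hA₂' k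
  · intro i; fin_cases i
    · exact h
    · exact h₂'
  · have hdvd : (1 - Polynomial.X : ℤ[X]) ^ (2 * n) ∣ A * C₂ - Polynomial.X * A₂ * C := by
      have hco : IsCoprime ((1 - Polynomial.X : ℤ[X]) ^ (2 * n)) (Polynomial.X ^ (2 * n)) :=
        IsCoprime.pow ⟨1, 1, by ring⟩
      refine hco.dvd_of_dvd_mul_left ⟨B₂.comp (1 - Polynomial.X) * C - B.comp (1 - Polynomial.X) * C₂, ?_⟩
      linear_combination C₂ * h - C * h₂'
    obtain ⟨q, hq⟩ := hdvd
    have hco : (A * C₂ - Polynomial.X * A₂ * C).coeff 0 = A.coeff 0 * C₂.coeff 0 := by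
      simp [mul_coeff_zero]
    have hne : A * C₂ - Polynomial.X * A₂ * C ≠ 0 := by
      intro h0
      rw [h0] at hco
      simp [hA0, hC₂0] at hco
    have hdeg : (A * C₂ - Polynomial.X * A₂ * C).natDegree ≤ 2 * n := by
      refine (natDegree_sub_le _ _).trans (max_le ?_ ?_) <;> refine natDegree_mul_le.trans ?_ <;>
        omega
    have hq0 : q ≠ 0 := by rintro rfl; simp [hq] at hne
    have h1X : (1 - Polynomial.X : ℤ[X]) ≠ 0 := by
      intro h0
      have := congrArg (fun p => p.coeff 0) h0
      simp at this
    have h1Xd : (1 - Polynomial.X : ℤ[X]).natDegree = 1 := by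
      rw [natDegree_sub, ← Polynomial.C_1, natDegree_X_sub_C]
    rw [hq, natDegree_mul (pow_ne_zero _ h1X) hq0, natDegree_pow, h1Xd] at hdeg
    have hqd : q.natDegree = 0 := by omega
    obtain ⟨c, rfl⟩ := natDegree_eq_zero.1 hqd
    refine ⟨c, by simpa using hq0, ?_⟩
    simp only [Matrix.cons_val_zero, Matrix.cons_val_one, hq]
    ring

theorem AbsoluteValue.apply_sum_le_of_isNonarchimedean {L : Type*} [Field L]
    (v : AbsoluteValue L ℝ) (hv : IsNonarchimedean v) {β : Type*} (s : Finset β) (f : β → L)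
    {M : ℝ} (hM : 0 ≤ M) (h : ∀ b ∈ s, v (f b) ≤ M) : v (∑ b ∈ s, f b) ≤ M := by
  classical
  induction s using Finset.induction_on with
  | empty => simpa using hM
  | insert a s ha ih =>
    rw [Finset.sum_insert ha]
    exact (hv _ _).trans (max_le (h a (by simp)) (ih fun b hb => h b (by simp [hb])))

/-- A finite family of absolute values on a field `L`, some archimedean and the others
nonarchimedean, together with a subring whose nonzero elements have norm at least one. -/
structure PlaceSystem (L ι : Type*) [Field L] [Fintype ι] where
  v : ι → AbsoluteValue L ℝ
  arch : Finset ι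
  isNonarchimedean : ∀ i ∉ arch, IsNonarchimedean (v i)
  arch_natCast : ∀ i ∈ arch, ∀ n : ℕ, v i n = n
  arch_nonempty : arch.Nonempty
  O : Subring L
  sum_log_nonneg : ∀ τ ∈ O, τ ≠ 0 → 0 ≤ ∑ i, Real.log (v i τ)

namespace PlaceSystem

variable {L ι : Type*} [Field L] [Fintype ι] (P : PlaceSystem L ι)

/-- The local height of the point `(x : y : 1)`. -/
def loc (i : ι) (x y : L) : ℝ := max 1 (max (P.v i x) (P.v i y))

/-- The logarithmic height of the point `(x : y : 1)`. -/
def ht (x y : L) : ℝ := ∑ i, Real.log (P.loc i x y)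

theorem one_le_loc (i : ι) (x y : L) : 1 ≤ P.loc i x y := le_max_left _ _

theorem loc_pos (i : ι) (x y : L) : 0 < P.loc i x y := one_pos.trans_le (P.one_le_loc i x y)

theorem le_loc_left (i : ι) (x y : L) : P.v i x ≤ P.loc i x y :=
  (le_max_left _ _).trans (le_max_right _ _)

theorem le_loc_right (i : ι) (x y : L) : P.v i y ≤ P.loc i x y :=
  (le_max_right _ _).trans (le_max_right _ _)

theorem sum_log_ite [DecidableEq ι] (K : ℝ) :
    ∑ i, Real.log (if i ∈ P.arch then K else 1) = P.arch.card * Real.log K := by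
  have : ∀ i, Real.log (if i ∈ P.arch then K else 1) =
      if i ∈ P.arch then Real.log K else 0 := fun i => by split_ifs <;> simp
  simp [this]

theorem v_intCast_le (i : ι) (hi : i ∈ P.arch) (c : ℤ) (B : ℕ) (hc : |c| ≤ B) :
    P.v i (c : L) ≤ B := by
  have h : P.v i (c : L) = (c.natAbs : ℝ) := by
    obtain ⟨k, rfl | rfl⟩ := c.eq_nat_or_neg <;> simp [P.arch_natCast i hi]
  rw [h]
  have : (c.natAbs : ℤ) ≤ B := by simpa using hc
  exact_mod_cast this

open Classical in
theorem v_aeval_le (i : ι) (p : Polynomial ℤ) (n B : ℕ) (hn : p.natDegree ≤ n)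
    (hB : ∀ k, |p.coeff k| ≤ B) (u : L) (H : ℝ) (hH : 1 ≤ H) (hu : P.v i u ≤ H) :
    P.v i (Polynomial.aeval u p) ≤ (if i ∈ P.arch then ((n + 1) * B : ℝ) else 1) * H ^ n := by
  rw [Polynomial.aeval_eq_sum_range' (Nat.lt_succ_of_le hn)]
  have hpow : ∀ k ∈ Finset.range (n + 1), P.v i u ^ k ≤ H ^ n := by
    intro k hk
    have hk' : k ≤ n := by simpa [Nat.lt_succ_iff] using hk
    exact (pow_le_pow_left₀ (apply_nonneg _ _) hu k).trans (pow_le_pow_right₀ hH hk')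
  split_ifs with hi
  · refine ((P.v i).sum_le _ _).trans ?_
    calc ∑ k ∈ Finset.range (n + 1), P.v i (p.coeff k • u ^ k)
        ≤ ∑ k ∈ Finset.range (n + 1), (B : ℝ) * H ^ n := by
          refine Finset.sum_le_sum fun k hk => ?_
          rw [zsmul_eq_mul, map_mul, map_pow]
          exact mul_le_mul (P.v_intCast_le i hi _ _ (hB k)) (hpow k hk)
            (pow_nonneg (apply_nonneg _ _) _) (Nat.cast_nonneg _)
      _ = _ := by simp; ring
  · rw [one_mul]
    refine (P.v i).apply_sum_le_of_isNonarchimedean (P.isNonarchimedean i hi) _ _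
      (pow_nonneg (zero_le_one.trans hH) _) fun k hk => ?_
    rw [zsmul_eq_mul, map_mul, map_pow]
    have h1 : P.v i ((p.coeff k : ℤ) : L) ≤ 1 :=
      IsNonarchimedean.apply_intCast_le_one (P.isNonarchimedean i hi)
    exact (mul_le_of_le_one_left (pow_nonneg (apply_nonneg _ _) _) h1).trans (hpow k hk)

open Classical in
theorem v_mul_sub_mul_le (i : ι) (s t a b : L) (K W : ℝ) (hs : P.v i s ≤ K) (ht : P.v i t ≤ K)
    (ha : P.v i a ≤ W) (hb : P.v i b ≤ W) :
    P.v i (s * a - t * b) ≤ (if i ∈ P.arch then 2 else 1) * (K * W) := by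
  have hK : 0 ≤ K := (apply_nonneg _ _).trans hs
  have h1 : P.v i (s * a) ≤ K * W := by
    rw [map_mul]; exact mul_le_mul hs ha (apply_nonneg _ _) hK
  have h2 : P.v i (t * b) ≤ K * W := by
    rw [map_mul]; exact mul_le_mul ht hb (apply_nonneg _ _) hK
  split_ifs with hi
  · rw [sub_eq_add_neg]
    refine ((P.v i).add_le _ _).trans ?_
    rw [AbsoluteValue.map_neg]
    linarith
  · rw [one_mul, sub_eq_add_neg]
    refine (P.isNonarchimedean i hi _ _).trans (max_le h1 ?_)
    rw [AbsoluteValue.map_neg]; exact h2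

/-- The basic height inequality obtained by eliminating between two linear relations. -/
theorem mul_ht_le_of_relation [DecidableEq ι] (x y a b A B C : L) (m n : ℕ) (K : ℝ) (hK : 1 ≤ K)
    (h1 : a * x ^ m + b * y ^ m = 1) (h2 : A * x ^ m + B * y ^ m = C)
    (hA : ∀ i, P.v i A ≤ (if i ∈ P.arch then K else 1) * P.loc i x y ^ n)
    (hB : ∀ i, P.v i B ≤ (if i ∈ P.arch then K else 1) * P.loc i x y ^ n)
    (hC : ∀ i, P.v i C ≤ (if i ∈ P.arch then K else 1) * P.loc i x y ^ n)
    (hmem : A * b - B * a ∈ P.O) (hne : A * b - B * a ≠ 0) :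
    m * P.ht x y ≤ n * P.ht x y + P.ht a b + P.arch.card * Real.log (2 * K) := by
  set τ := A * b - B * a with hτ
  have e1 : τ * x ^ m = C * b - B * 1 := by rw [hτ]; linear_combination b * h2 - B * h1
  have e2 : τ * y ^ m = A * 1 - C * a := by rw [hτ]; linear_combination A * h1 - a * h2
  have hloc : ∀ i, P.v i τ * P.loc i x y ^ m ≤
      (if i ∈ P.arch then 2 * K else 1) * (P.loc i x y ^ n * P.loc i a b) := by
    intro i
    have key : ∀ s t c d : L, P.v i s ≤ (if i ∈ P.arch then K else 1) * P.loc i x y ^ n →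
        P.v i t ≤ (if i ∈ P.arch then K else 1) * P.loc i x y ^ n →
        P.v i c ≤ P.loc i a b → P.v i d ≤ P.loc i a b →
        P.v i (s * c - t * d) ≤
          (if i ∈ P.arch then 2 * K else 1) * (P.loc i x y ^ n * P.loc i a b) := by
      intro s t c d hs ht hc hd
      have := P.v_mul_sub_mul_le i s t c d _ _ hs ht hc hd
      refine this.trans (le_of_eq ?_)
      split_ifs <;> ring
    have h1' : P.v i (1 : L) ≤ P.loc i a b := by simpa using P.one_le_loc i a b
    have k0 := key A B b a (hA i) (hB i) (P.le_loc_right i a b) (P.le_loc_left i a b)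
    have k1 := key C B b 1 (hC i) (hB i) (P.le_loc_right i a b) h1'
    have k2 := key A C 1 a (hA i) (hC i) h1' (P.le_loc_left i a b)
    rw [← hτ] at k0
    rw [← e1, map_mul, map_pow] at k1
    rw [← e2, map_mul, map_pow] at k2
    have hcases : P.loc i x y = 1 ∨ P.loc i x y = P.v i x ∨ P.loc i x y = P.v i y := by
      unfold loc
      rcases max_choice (1 : ℝ) (max (P.v i x) (P.v i y)) with h | h
      · exact Or.inl h
      · rcases max_choice (P.v i x) (P.v i y) with h' | h' <;> rw [h] <;> simp [h']
    rcases hcases with h | h | h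
    · rw [h, one_pow, mul_one]; rw [h] at k0; exact k0
    · nth_rewrite 1 [h]; exact k1
    · nth_rewrite 1 [h]; exact k2
  have hτpos : ∀ i, 0 < P.v i τ := fun i => (P.v i).pos hne
  have hsum : ∑ i, (Real.log (P.v i τ) + m * Real.log (P.loc i x y)) ≤
      ∑ i, (Real.log (if i ∈ P.arch then 2 * K else 1) + (n * Real.log (P.loc i x y) +
        Real.log (P.loc i a b))) := by
    refine Finset.sum_le_sum fun i _ => ?_
    have hp := P.loc_pos i x y
    have hq := P.loc_pos i a b
    have hk : (0 : ℝ) < if i ∈ P.arch then 2 * K else 1 := by split_ifs <;> linarith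
    have := Real.log_le_log (mul_pos (hτpos i) (pow_pos hp m)) (hloc i)
    rwa [Real.log_mul (hτpos i).ne' (pow_pos hp m).ne', Real.log_pow,
      Real.log_mul hk.ne' (mul_pos (pow_pos hp n) hq).ne',
      Real.log_mul (pow_pos hp n).ne' hq.ne', Real.log_pow] at this
  have h0 := P.sum_log_nonneg τ hmem hne
  simp only [Finset.sum_add_distrib, ← Finset.mul_sum, sum_log_ite] at hsum
  change _ + m * P.ht x y ≤ _ + (n * P.ht x y + P.ht a b) at hsum
  linarith

theorem ht_le_of_ne (x y a b : L) (h1 : a * x + b * y = 1) (h2 : x + y = 1) (ha : a ∈ P.O)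
    (hb : b ∈ P.O) (hne : a ≠ b) : P.ht x y ≤ P.ht a b + P.arch.card * Real.log 2 := by
  classical
  have one : ∀ i, P.v i (1 : L) ≤ (if i ∈ P.arch then (1 : ℝ) else 1) * P.loc i x y ^ 0 := by simp
  have := P.mul_ht_le_of_relation x y a b 1 1 1 1 0 1 le_rfl (by simpa using h1)
    (by simpa using h2) one one one (by simpa using sub_mem hb ha)
    (by simpa using sub_ne_zero.2 hne.symm)
  simpa using this

theorem mul_ht_le_of_pade [CharZero L] (x y a b : L) (n : ℕ) (hn : 1 ≤ n)
    (h1 : a * x ^ (2 * n) + b * y ^ (2 * n) = 1) (h2 : x + y = 1) (hx : x ∈ P.O) (hy : y ∈ P.O)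
    (ha : a ∈ P.O) (hb : b ∈ P.O) (hy0 : y ≠ 0) :
    n * P.ht x y ≤ P.ht a b + P.arch.card * Real.log (2 * ((n + 1) * 64 ^ n)) := by
  classical
  obtain ⟨A, B, C, hdeg, hcoeff, hrel, c, hc, hdet⟩ := exists_pade_pair n hn
  have hyx : Polynomial.aeval x (1 - Polynomial.X : Polynomial ℤ) = y := by
    simp; linear_combination -h2
  have hrel' : ∀ j, Polynomial.aeval x (A j) * x ^ (2 * n) +
      Polynomial.aeval y (B j) * y ^ (2 * n) = Polynomial.aeval x (C j) := by
    intro j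
    have := congrArg (Polynomial.aeval x) (hrel j)
    rwa [map_add, map_mul, map_mul, map_pow, map_pow, Polynomial.aeval_X, Polynomial.aeval_comp,
      hyx] at this
  have hmemO : ∀ (p : Polynomial ℤ) (u : L), u ∈ P.O → Polynomial.aeval u p ∈ P.O := by
    intro p u hu
    rw [Polynomial.aeval_eq_sum_range]
    exact sum_mem fun k _ => zsmul_mem (pow_mem hu _) _
  obtain ⟨j, hj⟩ : ∃ j, Polynomial.aeval x (A j) * b - Polynomial.aeval y (B j) * a ≠ 0 := by
    by_contra! hcon
    have hA : ∀ j, Polynomial.aeval x (A j) = Polynomial.aeval x (C j) * a := by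
      intro j
      linear_combination y ^ (2 * n) * hcon j + a * hrel' j - Polynomial.aeval x (A j) * h1
    have := congrArg (Polynomial.aeval x) hdet
    rw [map_sub, map_mul, map_mul, map_mul, map_pow, hyx, hA, hA, Polynomial.aeval_C] at this
    have h0 : (algebraMap ℤ L c) * y ^ (2 * n) = 0 := by rw [← this]; ring
    rcases mul_eq_zero.1 h0 with h | h
    · exact hc (by simpa using h)
    · exact hy0 ((pow_eq_zero_iff (by omega)).1 h)
  have hcast : ((64 ^ n : ℕ) : ℝ) = 64 ^ n := by norm_num
  have hbound : ∀ (i : ι) (p : Polynomial ℤ) (u : L), p.natDegree ≤ n →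
      (∀ k, |p.coeff k| ≤ 64 ^ n) → P.v i u ≤ P.loc i x y → P.v i (Polynomial.aeval u p) ≤
      (if i ∈ P.arch then ((n + 1) * 64 ^ n : ℝ) else 1) * P.loc i x y ^ n := by
    intro i p u hp hk hu
    have := P.v_aeval_le i p n (64 ^ n) hp (by simpa using hk) u _ (P.one_le_loc i x y) hu
    rwa [hcast] at this
  have h64 : (1 : ℝ) ≤ 64 ^ n := one_le_pow₀ (by norm_num)
  have := P.mul_ht_le_of_relation x y a b _ _ _ (2 * n) n ((n + 1) * 64 ^ n)
    (by nlinarith [(Nat.cast_nonneg n : (0 : ℝ) ≤ n)]) h1 (hrel' j)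
    (fun i => hbound i _ x (hdeg j).1 (fun k => (hcoeff j k).1) (P.le_loc_left i x y))
    (fun i => hbound i _ y (hdeg j).2.1 (fun k => (hcoeff j k).2.1) (P.le_loc_right i x y))
    (fun i => hbound i _ x (hdeg j).2.2 (fun k => (hcoeff j k).2.2) (P.le_loc_left i x y))
    (sub_mem (mul_mem (hmemO _ _ hx) hb) (mul_mem (hmemO _ _ hy) ha)) hj
  push_cast at this
  linarith

/-- The sum of seventh powers, reduced modulo seven. -/
theorem exists_sum_pow_seven (l : List L) (hl : ∀ m ∈ l, m ∈ P.O) :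
    ∃ q ∈ P.O, l.sum ^ 7 = (l.map (· ^ 7)).sum + 7 * q ∧
      ∀ i ∉ P.arch, ∀ M : ℝ, 0 ≤ M → (∀ m ∈ l, P.v i m ≤ M) →
        P.v i l.sum ≤ M ∧ P.v i q ≤ M ^ 7 := by
  induction l with
  | nil => exact ⟨0, zero_mem _, by simp, fun i _ M hM _ => by simp [hM]⟩
  | cons a l ih =>
    obtain ⟨q, hq, hsum, hbd⟩ := ih fun m hm => hl m (by simp [hm])
    set s := l.sum with hs
    have ha : a ∈ P.O := hl a (by simp)
    have hsO : s ∈ P.O := list_sum_mem fun m hm => hl m (by simp [hm])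
    refine ⟨q + a * s * (a + s) * (a ^ 2 + a * s + s ^ 2) ^ 2, ?_, ?_, ?_⟩
    · exact add_mem hq (mul_mem (mul_mem (mul_mem ha hsO) (add_mem ha hsO))
        (pow_mem (add_mem (add_mem (pow_mem ha _) (mul_mem ha hsO)) (pow_mem hsO _)) _))
    · simp only [List.sum_cons, List.map_cons, ← hs]
      linear_combination hsum
    · intro i hi M hM hm
      have hna := P.isNonarchimedean i hi
      obtain ⟨hs1, hq1⟩ := hbd i hi M hM fun m h => hm m (by simp [h])
      have ha1 : P.v i a ≤ M := hm a (by simp)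
      have has : P.v i (a + s) ≤ M := (hna _ _).trans (max_le ha1 hs1)
      have hz : ∀ z, 0 ≤ P.v i z := fun z => apply_nonneg _ _
      refine ⟨by simpa using has, (hna _ _).trans (max_le hq1 ?_)⟩
      have h2 : P.v i (a ^ 2 + a * s + s ^ 2) ≤ M ^ 2 := by
        refine (hna _ _).trans (max_le ((hna _ _).trans (max_le ?_ ?_)) ?_)
        · rw [map_pow]; exact pow_le_pow_left₀ (hz _) ha1 2
        · rw [map_mul, pow_two]; exact mul_le_mul ha1 hs1 (hz _) hM
        · rw [map_pow]; exact pow_le_pow_left₀ (hz _) hs1 2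
      rw [map_mul, map_mul, map_mul, map_pow]
      calc _ ≤ M * M * M * (M ^ 2) ^ 2 := by
            gcongr
        _ = M ^ 7 := by ring

theorem log_le_of_sum_eq_zero [CharZero L] (a b c d : L) (ha : a ∈ P.O) (hb : b ∈ P.O)
    (hc : c ∈ P.O) (hd : d ∈ P.O) (h0 : a * d - a - d - c * b + c + b = 0)
    (h7 : (a * d) ^ 7 - a ^ 7 - d ^ 7 - (c * b) ^ 7 + c ^ 7 + b ^ 7 ≠ 0) :
    P.arch.card * Real.log (7 / 6) ≤ 7 * (P.ht a b + P.ht c d) := by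
  classical
  set l : List L := [a * d, -a, -d, -(c * b), c, b] with hl
  have hlO : ∀ m ∈ l, m ∈ P.O := by
    intro m hm
    simp only [hl, List.mem_cons, List.not_mem_nil, or_false] at hm
    rcases hm with rfl | rfl | rfl | rfl | rfl | rfl
    · exact mul_mem ha hd
    · exact neg_mem ha
    · exact neg_mem hd
    · exact neg_mem (mul_mem hc hb)
    · exact hc
    · exact hb
  obtain ⟨q, hq, hsum, hbd⟩ := P.exists_sum_pow_seven l hlO
  have hls : l.sum = 0 := by simp only [hl, List.sum_cons, List.sum_nil]; linear_combination h0
  rw [hls] at hsum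
  have hmap : (l.map (· ^ 7)).sum =
      (a * d) ^ 7 - a ^ 7 - d ^ 7 - (c * b) ^ 7 + c ^ 7 + b ^ 7 := by
    simp only [hl, List.map_cons, List.map_nil, List.sum_cons, List.sum_nil]; ring
  have hq0 : q ≠ 0 := by
    rintro rfl
    apply h7
    rw [← hmap]
    linear_combination -hsum
  have hM : ∀ i, ∀ m ∈ l, P.v i m ≤ P.loc i a b * P.loc i c d := by
    intro i m hm
    have e1 := P.one_le_loc i a b
    have e2 := P.one_le_loc i c d
    have key : ∀ u w : L, P.v i u ≤ P.loc i a b → P.v i w ≤ P.loc i c d →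
        P.v i (u * w) ≤ P.loc i a b * P.loc i c d := fun u w hu hw => by
      rw [map_mul]; exact mul_le_mul hu hw (apply_nonneg _ _) (P.loc_pos i a b).le
    have o1 : P.v i (1 : L) ≤ P.loc i a b := by simpa using e1
    have o2 : P.v i (1 : L) ≤ P.loc i c d := by simpa using e2
    simp only [hl, List.mem_cons, List.not_mem_nil, or_false] at hm
    rcases hm with rfl | rfl | rfl | rfl | rfl | rfl
    · exact key _ _ (P.le_loc_left i a b) (P.le_loc_right i c d)
    · simpa using key a 1 (P.le_loc_left i a b) o2
    · simpa using key 1 d o1 (P.le_loc_right i c d)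
    · simpa [mul_comm] using key b c (P.le_loc_right i a b) (P.le_loc_left i c d)
    · simpa using key 1 m o1 (P.le_loc_left i m d)
    · simpa using key m 1 (P.le_loc_right i a m) o2
  have hloc : ∀ i, P.v i q ≤
      (if i ∈ P.arch then 6 / 7 else 1) * (P.loc i a b * P.loc i c d) ^ 7 := by
    intro i
    have hMpos : 0 ≤ P.loc i a b * P.loc i c d :=
      mul_nonneg (P.loc_pos i a b).le (P.loc_pos i c d).le
    split_ifs with hi
    · have e : 7 * q = -(l.map (· ^ 7)).sum := by linear_combination -hsum
      have e7 : P.v i (7 : L) = 7 := by simpa using P.arch_natCast i hi 7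
      have h := congrArg (P.v i) e
      rw [map_mul, e7, AbsoluteValue.map_neg] at h
      have hb : ∀ l' : List L, (∀ m ∈ l', P.v i m ≤ P.loc i a b * P.loc i c d) →
          P.v i (l'.map (· ^ 7)).sum ≤ l'.length * (P.loc i a b * P.loc i c d) ^ 7 := by
        intro l' hl'
        induction l' with
        | nil => simp
        | cons m l' ih =>
          simp only [List.map_cons, List.sum_cons, List.length_cons]
          have h1 := ih fun m hm => hl' m (by simp [hm])
          have h2 : P.v i (m ^ 7) ≤ (P.loc i a b * P.loc i c d) ^ 7 := by
            rw [map_pow]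
            exact pow_le_pow_left₀ (apply_nonneg _ _) (hl' m (by simp)) 7
          refine ((P.v i).add_le _ _).trans ?_
          push_cast
          linarith
      have h6 := hb l (hM i)
      have hlen : (l.length : ℝ) = 6 := by norm_num [hl]
      rw [hlen, ← h] at h6
      linarith
    · rw [one_mul]
      exact (hbd i hi _ hMpos (hM i)).2
  have hsum' : ∑ i, Real.log (P.v i q) ≤
      ∑ i, (Real.log (if i ∈ P.arch then 6 / 7 else 1) + 7 * (Real.log (P.loc i a b) +
        Real.log (P.loc i c d))) := by
    refine Finset.sum_le_sum fun i _ => ?_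
    have hp := P.loc_pos i a b
    have hq := P.loc_pos i c d
    have hk : (0 : ℝ) < if i ∈ P.arch then 6 / 7 else 1 := by split_ifs <;> norm_num
    have := Real.log_le_log ((P.v i).pos hq0) (hloc i)
    rwa [Real.log_mul hk.ne' (pow_pos (mul_pos hp hq) 7).ne', Real.log_pow,
      Real.log_mul hp.ne' hq.ne'] at this
  have h0 := P.sum_log_nonneg q hq hq0
  simp only [Finset.sum_add_distrib, ← Finset.mul_sum, sum_log_ite] at hsum'
  change _ ≤ _ + 7 * (P.ht a b + P.ht c d) at hsum'
  have hl67 : Real.log (6 / 7) = -Real.log (7 / 6) := by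
    rw [← Real.log_inv]; norm_num
  rw [hl67] at hsum'
  linarith

end PlaceSystem

namespace PlaceSystem

variable {L ι : Type*} [Field L] [Fintype ι] (P : PlaceSystem L ι)

/-- The space of pairs of real vectors indexed by the places. -/
abbrev LogSpace (ι : Type*) := PiLp 1 fun _ : ι × Fin 2 => ℝ

/-- The logarithmic embedding of pairs of nonzero elements. -/
def logEmb : Additive (Lˣ × Lˣ) →+ LogSpace ι where
  toFun z := WithLp.toLp 1 fun p =>
    Real.log (P.v p.1 (if p.2 = 0 then (z.toMul.1 : L) else (z.toMul.2 : L)))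
  map_zero' := by
    ext p
    simp
  map_add' z w := by
    ext p
    have h : ∀ u : Lˣ, P.v p.1 (u : L) ≠ 0 := fun u => (P.v p.1).ne_zero u.ne_zero
    simp only [toMul_add, Prod.fst_mul, Prod.snd_mul, PiLp.add_apply]
    split_ifs
    · rw [Units.val_mul, map_mul, Real.log_mul (h _) (h _)]
    · rw [Units.val_mul, map_mul, Real.log_mul (h _) (h _)]

theorem logEmb_apply_zero (z : Lˣ × Lˣ) (i : ι) :
    P.logEmb (Additive.ofMul z) (i, 0) = Real.log (P.v i z.1) := by simp [logEmb]

theorem logEmb_apply_one (z : Lˣ × Lˣ) (i : ι) :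
    P.logEmb (Additive.ofMul z) (i, 1) = Real.log (P.v i z.2) := by simp [logEmb]

/-- The height as a function on the logarithmic space. -/
def vecHt (w : LogSpace ι) : ℝ := ∑ i, max 0 (max (w (i, 0)) (w (i, 1)))

theorem ht_eq_vecHt (z : Lˣ × Lˣ) : P.ht z.1 z.2 = vecHt (P.logEmb (Additive.ofMul z)) := by
  unfold ht vecHt
  refine Finset.sum_congr rfl fun i _ => ?_
  rw [logEmb_apply_zero, logEmb_apply_one, loc]
  have h1 : 0 < P.v i (z.1 : L) := (P.v i).pos z.1.ne_zero
  have h2 : 0 < P.v i (z.2 : L) := (P.v i).pos z.2.ne_zero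
  have key : ∀ a b : ℝ, 0 < a → 0 < b → Real.log (max a b) = max (Real.log a) (Real.log b) :=
    fun a b ha hb => Real.strictMonoOn_log.monotoneOn.map_max ha hb
  rw [key _ _ one_pos (lt_max_of_lt_left h1), key _ _ h1 h2, Real.log_one]

theorem vecHt_nonneg (w : LogSpace ι) : 0 ≤ vecHt w :=
  Finset.sum_nonneg fun _ _ => le_max_left _ _

theorem vecHt_add_le (u w : LogSpace ι) : vecHt (u + w) ≤ vecHt u + vecHt w := by
  unfold vecHt
  rw [← Finset.sum_add_distrib]
  refine Finset.sum_le_sum fun i _ => ?_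
  simp only [PiLp.add_apply]
  refine max_le (add_nonneg (le_max_left _ _) (le_max_left _ _)) (max_le ?_ ?_)
  · exact add_le_add ((le_max_left _ _).trans (le_max_right _ _))
      ((le_max_left _ _).trans (le_max_right _ _))
  · exact add_le_add ((le_max_right _ _).trans (le_max_right _ _))
      ((le_max_right _ _).trans (le_max_right _ _))

theorem vecHt_smul {c : ℝ} (hc : 0 ≤ c) (w : LogSpace ι) : vecHt (c • w) = c * vecHt w := by
  unfold vecHt
  rw [Finset.mul_sum]
  refine Finset.sum_congr rfl fun i _ => ?_
  simp only [PiLp.smul_apply, smul_eq_mul]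
  rw [mul_max_of_nonneg _ _ hc, mul_max_of_nonneg _ _ hc, mul_zero]

theorem norm_eq_sum (w : LogSpace ι) : ‖w‖ = ∑ i, (|w (i, 0)| + |w (i, 1)|) := by
  rw [PiLp.norm_eq_of_L1, Fintype.sum_prod_type]
  simp

theorem vecHt_le_norm (w : LogSpace ι) : vecHt w ≤ ‖w‖ := by
  rw [norm_eq_sum]
  unfold vecHt
  refine Finset.sum_le_sum fun i _ => ?_
  have h1 := abs_nonneg (w (i, 0))
  have h2 := abs_nonneg (w (i, 1))
  have h3 := le_abs_self (w (i, 0))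
  have h4 := le_abs_self (w (i, 1))
  exact max_le (by linarith) (max_le (by linarith) (by linarith))

theorem norm_le_vecHt (w : LogSpace ι) (h0 : ∑ i, w (i, 0) = 0) (h1 : ∑ i, w (i, 1) = 0) :
    ‖w‖ ≤ 4 * vecHt w := by
  have : ‖w‖ + (∑ i, w (i, 0) + ∑ i, w (i, 1)) ≤ 4 * vecHt w := by
    rw [norm_eq_sum]
    unfold vecHt
    rw [← Finset.sum_add_distrib, ← Finset.sum_add_distrib, Finset.mul_sum]
    refine Finset.sum_le_sum fun i _ => ?_
    rcases abs_cases (w (i, 0)) with ⟨h, _⟩ | ⟨h, _⟩ <;>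
      rcases abs_cases (w (i, 1)) with ⟨h', _⟩ | ⟨h', _⟩ <;>
      rcases max_cases (w (i, 0)) (w (i, 1)) with ⟨h'', _⟩ | ⟨h'', _⟩ <;>
      rw [h, h', h''] <;>
      [have := le_max_right 0 (w (i, 0)); have := le_max_right 0 (w (i, 1));
       have := le_max_right 0 (w (i, 0)); have := le_max_right 0 (w (i, 1));
       have := le_max_right 0 (w (i, 0)); have := le_max_right 0 (w (i, 1));
       have := le_max_left 0 (w (i, 0)); have := le_max_left 0 (w (i, 1))] <;> linarith
  linarith

theorem vecHt_neg_le (w : LogSpace ι) (h0 : ∑ i, w (i, 0) = 0) (h1 : ∑ i, w (i, 1) = 0) :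
    vecHt (-w) ≤ 2 * vecHt w := by
  have : vecHt (-w) + (∑ i, w (i, 0) + ∑ i, w (i, 1)) ≤ 2 * vecHt w := by
    unfold vecHt
    rw [← Finset.sum_add_distrib, ← Finset.sum_add_distrib, Finset.mul_sum]
    refine Finset.sum_le_sum fun i _ => ?_
    simp only [PiLp.neg_apply]
    have e1 := le_max_left 0 (max (w (i, 0)) (w (i, 1)))
    have e2 := (le_max_left (w (i, 0)) (w (i, 1))).trans (le_max_right 0 _)
    have e3 := (le_max_right (w (i, 0)) (w (i, 1))).trans (le_max_right 0 _)
    have : max 0 (max (-w (i, 0)) (-w (i, 1))) ≤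
        2 * max 0 (max (w (i, 0)) (w (i, 1))) - (w (i, 0) + w (i, 1)) :=
      max_le (by linarith) (max_le (by linarith) (by linarith))
    linarith
  linarith

theorem vecHt_smul_le (w : LogSpace ι) (h0 : ∑ i, w (i, 0) = 0) (h1 : ∑ i, w (i, 1) = 0)
    (c : ℝ) : vecHt (c • w) ≤ max c (-2 * c) * vecHt w := by
  rcases le_total 0 c with hc | hc
  · rw [vecHt_smul hc]
    exact mul_le_mul_of_nonneg_right (le_max_left _ _) (vecHt_nonneg w)
  · have : c • w = (-c) • (-w) := by simp
    rw [this, vecHt_smul (by linarith)]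
    calc -c * vecHt (-w) ≤ -c * (2 * vecHt w) :=
          mul_le_mul_of_nonneg_left (vecHt_neg_le w h0 h1) (by linarith)
      _ = (-2 * c) * vecHt w := by ring
      _ ≤ _ := mul_le_mul_of_nonneg_right (le_max_right _ _) (vecHt_nonneg w)

theorem sum_log_eq_zero (u : Lˣ) (hu : (u : L) ∈ P.O) (hu' : ((u⁻¹ : Lˣ) : L) ∈ P.O) :
    ∑ i, Real.log (P.v i u) = 0 := by
  have h1 := P.sum_log_nonneg u hu u.ne_zero
  have h2 := P.sum_log_nonneg _ hu' (u⁻¹).ne_zero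
  simp only [Units.val_inv_eq_inv_val, map_inv₀, Real.log_inv, Finset.sum_neg_distrib] at h2
  linarith

/-- The group of units of the subring of a place system, as a subgroup of the multiplicative group
of the field. -/
def unitSubgroup : Subgroup Lˣ where
  carrier := {u | (u : L) ∈ P.O ∧ ((u⁻¹ : Lˣ) : L) ∈ P.O}
  mul_mem' := fun ha hb => ⟨by simpa using mul_mem ha.1 hb.1,
    by simpa [mul_comm] using mul_mem ha.2 hb.2⟩
  one_mem' := ⟨by simp [one_mem], by simp [one_mem]⟩
  inv_mem' := fun ha => ⟨ha.2, by simpa using ha.1⟩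

theorem sum_logEmb_zero (z : Lˣ × Lˣ) (h : z.1 ∈ P.unitSubgroup) :
    ∑ i, P.logEmb (Additive.ofMul z) (i, 0) = 0 := by
  simp only [logEmb_apply_zero]
  exact P.sum_log_eq_zero _ h.1 h.2

theorem sum_logEmb_one (z : Lˣ × Lˣ) (h : z.2 ∈ P.unitSubgroup) :
    ∑ i, P.logEmb (Additive.ofMul z) (i, 1) = 0 := by
  simp only [logEmb_apply_one]
  exact P.sum_log_eq_zero _ h.1 h.2

/-- The solutions of the unit equation `x + y = 1`. -/
def IsSol (z : Lˣ × Lˣ) : Prop :=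
  z.1 ∈ P.unitSubgroup ∧ z.2 ∈ P.unitSubgroup ∧ (z.1 : L) + z.2 = 1

variable {P}

theorem IsSol.vecHt_le {z w : Lˣ × Lˣ} (hz : P.IsSol z) (hw : P.IsSol w) (hne : z ≠ w) :
    vecHt (P.logEmb (Additive.ofMul z)) ≤
      vecHt (P.logEmb (Additive.ofMul w) - P.logEmb (Additive.ofMul z)) +
        P.arch.card * Real.log 2 := by
  have h := P.ht_le_of_ne (z.1 : L) z.2 (w / z).1 (w / z).2
    (by rw [Prod.fst_div, Prod.snd_div, ← Units.val_mul, ← Units.val_mul, div_mul_cancel,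
      div_mul_cancel, hw.2.2]) hz.2.2
    (P.unitSubgroup.div_mem hw.1 hz.1).1 (P.unitSubgroup.div_mem hw.2.1 hz.2.1).1 ?_
  · rwa [ht_eq_vecHt, ht_eq_vecHt, ofMul_div, map_sub] at h
  · intro heq
    have e := Units.ext heq
    have h1 : (w.1 : L) = (w / z).1 * z.1 := by rw [← Units.val_mul]; simp
    have h2 : (w.2 : L) = (w / z).1 * z.2 := by rw [← Units.val_mul, e]; simp
    have h3 : (((w / z).1 : Lˣ) : L) = 1 := by
      have := hw.2.2
      rw [h1, h2, ← mul_add, hz.2.2, mul_one] at this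
      exact this
    rw [h3, one_mul] at h1 h2
    exact hne (Prod.ext (Units.ext h1.symm) (Units.ext h2.symm))

theorem log_pade_le (n : ℕ) (hn : 1 ≤ n) : Real.log (2 * ((n + 1) * 64 ^ n)) ≤ 6 * n := by
  have h1 : (2 * (n + 1) : ℝ) ≤ 4 ^ n := by
    have : 2 * (n + 1) ≤ 4 ^ n := by
      induction n, hn using Nat.le_induction with
      | base => norm_num
      | succ n hn ih => rw [pow_succ]; omega
    exact_mod_cast this
  have h2 : (2 * ((n + 1) * 64 ^ n) : ℝ) ≤ 2 ^ (8 * n) := by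
    calc (2 * ((n + 1) * 64 ^ n) : ℝ) = (2 * (n + 1)) * 64 ^ n := by ring
      _ ≤ 4 ^ n * 64 ^ n := by gcongr
      _ = 2 ^ (8 * n) := by rw [← mul_pow, pow_mul]; norm_num
  calc _ ≤ Real.log (2 ^ (8 * n)) := Real.log_le_log (by positivity) h2
    _ = 8 * n * Real.log 2 := by rw [Real.log_pow]; push_cast; ring
    _ ≤ 6 * n := by
      have := Real.log_two_lt_d9
      nlinarith [(Nat.cast_nonneg n : (0 : ℝ) ≤ n)]

theorem IsSol.mul_vecHt_le [CharZero L] {z w : Lˣ × Lˣ} (hz : P.IsSol z) (hw : P.IsSol w) (n : ℕ)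
    (hn : 1 ≤ n) :
    n * vecHt (P.logEmb (Additive.ofMul z)) ≤
      vecHt (P.logEmb (Additive.ofMul w) - (2 * n : ℝ) • P.logEmb (Additive.ofMul z)) +
        P.arch.card * (6 * n) := by
  have h := P.mul_ht_le_of_pade (z.1 : L) z.2 (w / z ^ (2 * n)).1 (w / z ^ (2 * n)).2 n hn
    (by rw [Prod.fst_div, Prod.snd_div, ← Units.val_pow_eq_pow_val, ← Units.val_pow_eq_pow_val,
      ← Units.val_mul, ← Units.val_mul, Prod.pow_fst, Prod.pow_snd, div_mul_cancel,
      div_mul_cancel, hw.2.2]) hz.2.2 hz.1.1 hz.2.1.1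
    (P.unitSubgroup.div_mem hw.1 (P.unitSubgroup.pow_mem hz.1 _)).1
    (P.unitSubgroup.div_mem hw.2.1 (P.unitSubgroup.pow_mem hz.2.1 _)).1 z.2.ne_zero
  rw [ht_eq_vecHt, ht_eq_vecHt, ofMul_div, map_sub, ofMul_pow, map_nsmul,
    ← Nat.cast_smul_eq_nsmul ℝ] at h
  push_cast at h
  refine h.trans ?_
  have := mul_le_mul_of_nonneg_left (log_pade_le n hn) (Nat.cast_nonneg (α := ℝ) P.arch.card)
  linarith

theorem IsSol.card_mul_log_le [CharZero L] {x y z : Lˣ × Lˣ} (hx : P.IsSol x) (hy : P.IsSol y)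
    (hz : P.IsSol z)
    (hne : (x.1 : L) ^ 7 * (y.2 : L) ^ 7 - (y.1 : L) ^ 7 * (x.2 : L) ^ 7 +
      ((y.1 : L) ^ 7 * (z.2 : L) ^ 7 - (z.1 : L) ^ 7 * (y.2 : L) ^ 7) +
      ((z.1 : L) ^ 7 * (x.2 : L) ^ 7 - (x.1 : L) ^ 7 * (z.2 : L) ^ 7) ≠ 0) :
    P.arch.card * Real.log (7 / 6) ≤
      7 * (vecHt (P.logEmb (Additive.ofMul y) - P.logEmb (Additive.ofMul x)) +
        vecHt (P.logEmb (Additive.ofMul z) - P.logEmb (Additive.ofMul x))) := by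
  have y1 : (y.1 : L) = (y / x).1 * x.1 := by rw [← Units.val_mul]; simp
  have y2 : (y.2 : L) = (y / x).2 * x.2 := by rw [← Units.val_mul]; simp
  have z1 : (z.1 : L) = (z / x).1 * x.1 := by rw [← Units.val_mul]; simp
  have z2 : (z.2 : L) = (z / x).2 * x.2 := by rw [← Units.val_mul]; simp
  have hxe := hx.2.2
  have hye := hy.2.2
  have hze := hz.2.2
  have hx0 : (x.1 : L) ≠ 0 := x.1.ne_zero
  have h := P.log_le_of_sum_eq_zero ((y / x).1 : L) (y / x).2 (z / x).1 (z / x).2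
    (P.unitSubgroup.div_mem hy.1 hx.1).1 (P.unitSubgroup.div_mem hy.2.1 hx.2.1).1
    (P.unitSubgroup.div_mem hz.1 hx.1).1 (P.unitSubgroup.div_mem hz.2.1 hx.2.1).1 ?_ ?_
  · rwa [ht_eq_vecHt, ht_eq_vecHt, ofMul_div, map_sub, ofMul_div, map_sub] at h
  · rw [y1, y2] at hye
    rw [z1, z2] at hze
    generalize (((y / x).1 : Lˣ) : L) = a at *
    generalize (((y / x).2 : Lˣ) : L) = b at *
    generalize (((z / x).1 : Lˣ) : L) = c at *
    generalize (((z / x).2 : Lˣ) : L) = d at *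
    apply mul_left_cancel₀ hx0
    linear_combination (b - d) * hxe - (1 - d) * hye + (1 - b) * hze
  · intro h0
    apply hne
    rw [y1, y2, z1, z2]
    linear_combination (x.1 : L) ^ 7 * (x.2 : L) ^ 7 * h0

/-- A family of more than seven solutions contains three whose coordinatewise seventh powers are
not collinear. -/
theorem exists_not_collinear [CharZero L] (s : Finset (Lˣ × Lˣ)) (hs : ∀ z ∈ s, P.IsSol z)
    (hcard : 7 < s.card) : ∃ x ∈ s, ∃ y ∈ s, ∃ z ∈ s,
      (x.1 : L) ^ 7 * (y.2 : L) ^ 7 - (y.1 : L) ^ 7 * (x.2 : L) ^ 7 +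
      ((y.1 : L) ^ 7 * (z.2 : L) ^ 7 - (z.1 : L) ^ 7 * (y.2 : L) ^ 7) +
      ((z.1 : L) ^ 7 * (x.2 : L) ^ 7 - (x.1 : L) ^ 7 * (z.2 : L) ^ 7) ≠ 0 := by
  classical
  by_contra! hcon
  have hinj : Set.InjOn (fun z : Lˣ × Lˣ => (z.1 : L)) s := by
    intro z hz w hw h
    have h1 := (hs z hz).2.2
    have h2 := (hs w hw).2.2
    have h' : (z.1 : L) = w.1 := h
    refine Prod.ext (Units.ext h') (Units.ext ?_)
    linear_combination h1 - h2 - h'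
  have roots : ∀ p : Polynomial L, p ≠ 0 → p.natDegree ≤ 7 →
      ¬ ∀ z ∈ s, p.eval (z.1 : L) = 0 := by
    intro p hp hdeg hz
    have hsub : s.image (fun z : Lˣ × Lˣ => (z.1 : L)) ⊆ p.roots.toFinset := by
      intro u hu
      obtain ⟨z, hzs, rfl⟩ := Finset.mem_image.1 hu
      simpa [hp] using hz z hzs
    have h1 := Finset.card_le_card hsub
    rw [Finset.card_image_of_injOn hinj] at h1
    have h2 := p.roots.toFinset_card_le
    have h3 := p.card_roots'
    omega
  obtain ⟨x, hx⟩ : s.Nonempty := Finset.card_pos.1 (by omega)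
  have hex : ∃ y ∈ s, (y.1 : L) ^ 7 ≠ (x.1 : L) ^ 7 := by
    by_contra! h
    refine roots (Polynomial.X ^ 7 - Polynomial.C ((x.1 : L) ^ 7))
      (Polynomial.X_pow_sub_C_ne_zero (by norm_num) _)
      (by rw [Polynomial.natDegree_X_pow_sub_C]) fun z hz => ?_
    simp [h z hz]
  obtain ⟨y, hy, hyx⟩ := hex
  set α : L := (x.2 : L) ^ 7 - (y.2 : L) ^ 7 with hα
  set β : L := (y.1 : L) ^ 7 - (x.1 : L) ^ 7 with hβ
  have hβ0 : β ≠ 0 := sub_ne_zero.2 hyx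
  set δ : L := (x.1 : L) ^ 7 * (y.2 : L) ^ 7 - (y.1 : L) ^ 7 * (x.2 : L) ^ 7
  set q : Polynomial L := Polynomial.C α * Polynomial.X ^ 7 +
    Polynomial.C β * (1 - Polynomial.X) ^ 7 + Polynomial.C δ with hq
  have hexp : q = Polynomial.C (α - β) * Polynomial.X ^ 7 + Polynomial.C (7 * β) * Polynomial.X ^ 6 +
      Polynomial.C (-21 * β) * Polynomial.X ^ 5 + Polynomial.C (35 * β) * Polynomial.X ^ 4 +
      Polynomial.C (-35 * β) * Polynomial.X ^ 3 + Polynomial.C (21 * β) * Polynomial.X ^ 2 +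
      Polynomial.C (-7 * β) * Polynomial.X ^ 1 + Polynomial.C (β + δ) * Polynomial.X ^ 0 := by
    rw [hq]
    simp only [map_mul, map_neg, map_sub, map_add, map_ofNat]
    ring
  have hco : q.coeff 6 = 7 * β := by
    rw [hexp]
    simp only [Polynomial.coeff_add, Polynomial.coeff_C_mul_X_pow]
    norm_num
  have hq0 : q ≠ 0 := by
    intro h
    rw [h] at hco
    simp [hβ0] at hco
  refine roots q hq0 ?_ fun z hz => ?_
  · rw [hq]; compute_degree
  · have h := hcon x hx y hy z hz
    have hz' : 1 - (z.1 : L) = z.2 := by linear_combination -(hs z hz).2.2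
    simp only [hq, Polynomial.eval_add, Polynomial.eval_mul, Polynomial.eval_C,
      Polynomial.eval_pow, Polynomial.eval_sub, Polynomial.eval_one, Polynomial.eval_X, hz']
    linear_combination h

/-- The bound for the number of solutions of the unit equation in terms of the number of
generators. -/
def unitBound (r : ℕ) : ℕ := 2 * 1601 ^ (2 * r) + 7 * 1600001 ^ (2 * r)

theorem finrank_span_logEmb_le {r : ℕ} (g : Fin r → Lˣ) :
    Module.finrank ℝ (Submodule.span ℝ (Set.range fun p : Fin r × Fin 2 =>
      P.logEmb (Additive.ofMul (if p.2 = 0 then (g p.1, 1) else (1, g p.1))))) ≤ 2 * r := by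
  refine (finrank_range_le_card _).trans ?_
  simp [mul_comm]

theorem logEmb_mem_span {r : ℕ} (g : Fin r → Lˣ) (z : Lˣ × Lˣ)
    (h1 : z.1 ∈ Subgroup.closure (Set.range g)) (h2 : z.2 ∈ Subgroup.closure (Set.range g)) :
    P.logEmb (Additive.ofMul z) ∈ Submodule.span ℝ (Set.range fun p : Fin r × Fin 2 =>
      P.logEmb (Additive.ofMul (if p.2 = 0 then (g p.1, 1) else (1, g p.1)))) := by
  have key1 : ∀ u ∈ Subgroup.closure (Set.range g), P.logEmb (Additive.ofMul (u, 1)) ∈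
      Submodule.span ℝ (Set.range fun p : Fin r × Fin 2 =>
      P.logEmb (Additive.ofMul (if p.2 = 0 then (g p.1, 1) else (1, g p.1)))) := by
    intro u hu
    induction hu using Subgroup.closure_induction with
    | mem u hu =>
      obtain ⟨k, rfl⟩ := hu
      exact Submodule.subset_span ⟨(k, 0), by simp⟩
    | one => rw [← Prod.one_eq_mk, ofMul_one, map_zero]; exact zero_mem _
    | mul a b _ _ ha hb =>
      rw [show ((a * b, 1) : Lˣ × Lˣ) = (a, 1) * (b, 1) by simp, ofMul_mul, map_add]
      exact add_mem ha hb
    | inv a _ ha =>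
      rw [show ((a⁻¹, 1) : Lˣ × Lˣ) = (a, 1)⁻¹ by simp, ofMul_inv, map_neg]
      exact neg_mem ha
  have key2 : ∀ u ∈ Subgroup.closure (Set.range g), P.logEmb (Additive.ofMul (1, u)) ∈
      Submodule.span ℝ (Set.range fun p : Fin r × Fin 2 =>
      P.logEmb (Additive.ofMul (if p.2 = 0 then (g p.1, 1) else (1, g p.1)))) := by
    intro u hu
    induction hu using Subgroup.closure_induction with
    | mem u hu =>
      obtain ⟨k, rfl⟩ := hu
      exact Submodule.subset_span ⟨(k, 1), by simp⟩
    | one => rw [← Prod.one_eq_mk, ofMul_one, map_zero]; exact zero_mem _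
    | mul a b _ _ ha hb =>
      rw [show ((1, a * b) : Lˣ × Lˣ) = (1, a) * (1, b) by simp, ofMul_mul, map_add]
      exact add_mem ha hb
    | inv a _ ha =>
      rw [show ((1, a⁻¹) : Lˣ × Lˣ) = (1, a)⁻¹ by simp, ofMul_inv, map_neg]
      exact neg_mem ha
  rw [show z = (z.1, 1) * (1, z.2) by simp, ofMul_mul, map_add]
  exact add_mem (key1 _ h1) (key2 _ h2)

/-- Two distinct solutions of large height pointing in almost the same direction have heights of
different but comparable sizes. -/
theorem gap_principle [CharZero L] {z w : Lˣ × Lˣ} (hz : P.IsSol z) (hw : P.IsSol w)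
    (hne : z ≠ w)
    (hlz : 1000 * P.arch.card ≤ vecHt (P.logEmb (Additive.ofMul z)))
    (hle : vecHt (P.logEmb (Additive.ofMul z)) ≤ vecHt (P.logEmb (Additive.ofMul w)))
    (hclose : ‖(vecHt (P.logEmb (Additive.ofMul w)))⁻¹ • P.logEmb (Additive.ofMul w) -
      (vecHt (P.logEmb (Additive.ofMul z)))⁻¹ • P.logEmb (Additive.ofMul z)‖ ≤ 1 / 100) :
    2.9 * vecHt (P.logEmb (Additive.ofMul z)) ≤ vecHt (P.logEmb (Additive.ofMul w)) ∧
      vecHt (P.logEmb (Additive.ofMul w)) < 6 * vecHt (P.logEmb (Additive.ofMul z)) := by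
  have hD : (1 : ℝ) ≤ P.arch.card := by exact_mod_cast P.arch_nonempty.card_pos
  have hz0 := P.sum_logEmb_zero z hz.1
  have hz1 := P.sum_logEmb_one z hz.2.1
  have hA := hz.vecHt_le hw hne
  have hB := fun n hn => hz.mul_vecHt_le hw n hn
  set ζ := P.logEmb (Additive.ofMul z) with hζ
  set ω := P.logEmb (Additive.ofMul w) with hω
  set a := vecHt ζ with ha
  set b := vecHt ω with hb
  have hapos : 0 < a := by linarith
  have hbpos : 0 < b := by linarith
  have key : ∀ c : ℝ, vecHt (ω - c • ζ) ≤ b / 100 + max (b - c * a) (2 * (c * a - b)) := by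
    intro c
    have e : ω - c • ζ = b • (b⁻¹ • ω - a⁻¹ • ζ) + (b / a - c) • ζ := by
      rw [smul_sub, smul_smul, smul_smul, mul_inv_cancel₀ hbpos.ne', one_smul, sub_smul,
        div_eq_mul_inv]
      abel
    rw [e]
    refine (vecHt_add_le _ _).trans (add_le_add ?_ ?_)
    · rw [vecHt_smul hbpos.le]
      have := (vecHt_le_norm _).trans hclose
      nlinarith
    · refine (vecHt_smul_le ζ hz0 hz1 _).trans (le_of_eq ?_)
      rw [← ha, max_mul_of_nonneg _ _ hapos.le]
      congr 1
      · field_simp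
      · field_simp
        ring
  have hlog : Real.log 2 ≤ 1 := by have := Real.log_two_lt_d9; linarith
  have hl2 : (P.arch.card : ℝ) * Real.log 2 ≤ a / 1000 := by nlinarith
  have h0 := key 1
  rw [one_smul] at h0
  have hlam : 1.97 * a ≤ b := by
    rw [max_eq_left (by linarith)] at h0
    linarith
  have hn : ∀ n : ℕ, 1 ≤ n → n * a ≤ b / 100 + max (b - 2 * n * a) (2 * (2 * n * a - b)) +
      a / 1000 * (6 * n) := by
    intro n hn
    have h1 := hB n hn
    have h2 := key (2 * n)
    have h3 : (P.arch.card : ℝ) * (6 * n) ≤ a / 1000 * (6 * n) :=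
      mul_le_mul_of_nonneg_right (by linarith) (by positivity)
    linarith
  constructor
  · have h := hn 1 le_rfl
    push_cast at h
    rcases max_choice (b - 2 * 1 * a) (2 * (2 * 1 * a - b)) with hm | hm <;> rw [hm] at h <;>
      linarith
  · by_contra! hcon
    have hfl := Nat.floor_le (a := b / (2 * a)) (by positivity)
    have hlt := Nat.lt_floor_add_one (b / (2 * a))
    set n := ⌊b / (2 * a)⌋₊ with hndef
    have hn3 : 3 ≤ n := by
      apply Nat.le_floor
      rw [le_div_iff₀ (by positivity)]
      push_cast
      linarith
    have h3 : (3 : ℝ) ≤ n := by exact_mod_cast hn3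
    rw [le_div_iff₀ (by positivity)] at hfl
    rw [div_lt_iff₀ (by positivity)] at hlt
    have h := hn n (by omega)
    rw [max_eq_left (by linarith)] at h
    nlinarith

theorem card_solutions_le [CharZero L] {r : ℕ} (g : Fin r → Lˣ)
    (hg : ∀ k, g k ∈ P.unitSubgroup) (s : Finset (Lˣ × Lˣ))
    (hs : ∀ z ∈ s, z.1 ∈ Subgroup.closure (Set.range g) ∧
      z.2 ∈ Subgroup.closure (Set.range g) ∧ (z.1 : L) + z.2 = 1) :
    s.card ≤ unitBound r := by
  classical
  have hcl : Subgroup.closure (Set.range g) ≤ P.unitSubgroup := by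
    rw [Subgroup.closure_le]; rintro _ ⟨k, rfl⟩; exact hg k
  have hsol : ∀ z ∈ s, P.IsSol z := fun z hz =>
    ⟨hcl (hs z hz).1, hcl (hs z hz).2.1, (hs z hz).2.2⟩
  set E := Submodule.span ℝ (Set.range fun p : Fin r × Fin 2 =>
      P.logEmb (Additive.ofMul (if p.2 = 0 then (g p.1, 1) else (1, g p.1)))) with hE
  have hfin : Module.finrank ℝ E ≤ 2 * r := finrank_span_logEmb_le g
  have hmem : ∀ z ∈ s, P.logEmb (Additive.ofMul z) ∈ E := fun z hz =>
    logEmb_mem_span g z (hs z hz).1 (hs z hz).2.1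
  have hD : (1 : ℝ) ≤ P.arch.card := by exact_mod_cast P.arch_nonempty.card_pos
  have hnorm : ∀ z ∈ s, ‖P.logEmb (Additive.ofMul z)‖ ≤ 4 * vecHt (P.logEmb (Additive.ofMul z)) :=
    fun z hz => norm_le_vecHt _ (P.sum_logEmb_zero z (hsol z hz).1)
      (P.sum_logEmb_one z (hsol z hz).2.1)
  set big := s.filter fun z => 1000 * (P.arch.card : ℝ) ≤ vecHt (P.logEmb (Additive.ofMul z))
  set small := s.filter fun z => ¬ 1000 * (P.arch.card : ℝ) ≤ vecHt (P.logEmb (Additive.ofMul z))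
  have hsplit : big.card + small.card = s.card := Finset.card_filter_add_card_filter_not _
  have hbig : big.card ≤ 1601 ^ (2 * r) * 2 := by
    by_contra! hcon
    obtain ⟨t, hts, htc, htd⟩ := exists_close_subfamily hfin 800 2 big
      (fun z => if h : z ∈ s then (⟨(200 * (vecHt (P.logEmb (Additive.ofMul z)))⁻¹) •
        P.logEmb (Additive.ofMul z), E.smul_mem _ (hmem z h)⟩ : E) else 0) (by
        intro z hz
        have hz' := Finset.mem_filter.1 hz
        have hpos : 0 < vecHt (P.logEmb (Additive.ofMul z)) := by linarith [hz'.2]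
        rw [dif_pos hz'.1, Submodule.coe_norm, norm_smul, Real.norm_of_nonneg (by positivity)]
        have := hnorm z hz'.1
        rw [mul_assoc, inv_mul_eq_div]
        have h4 : ‖P.logEmb (Additive.ofMul z)‖ / vecHt (P.logEmb (Additive.ofMul z)) ≤ 4 := by
          rw [div_le_iff₀ hpos]; exact this
        push_cast; linarith) (by norm_num; exact hcon)
    have hgap : ∀ z ∈ t, ∀ w ∈ t, z ≠ w →
        vecHt (P.logEmb (Additive.ofMul z)) ≤ vecHt (P.logEmb (Additive.ofMul w)) →
        2.9 * vecHt (P.logEmb (Additive.ofMul z)) ≤ vecHt (P.logEmb (Additive.ofMul w)) ∧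
        vecHt (P.logEmb (Additive.ofMul w)) < 6 * vecHt (P.logEmb (Additive.ofMul z)) := by
      intro z hz w hw hne hle
      have hz' := Finset.mem_filter.1 (hts hz)
      have hw' := Finset.mem_filter.1 (hts hw)
      refine gap_principle (hsol z hz'.1) (hsol w hw'.1) hne hz'.2 hle ?_
      have h := htd w hw z hz
      rw [dif_pos hz'.1, dif_pos hw'.1, Submodule.coe_norm] at h
      simp only [AddSubgroupClass.coe_sub, mul_smul] at h
      rw [← smul_sub, norm_smul] at h
      norm_num at h
      norm_num
      linarith
    obtain ⟨x, hx, y, hy, z, hz, hxy, hxz, hyz⟩ := Finset.two_lt_card.1 htc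
    have hp : ∀ u ∈ t, 0 < vecHt (P.logEmb (Additive.ofMul u)) := fun u hu => by
      linarith [(Finset.mem_filter.1 (hts hu)).2]
    have px := hp x hx
    have py := hp y hy
    have pz := hp z hz
    have gxy := hgap x hx y hy hxy
    have gyx := hgap y hy x hx hxy.symm
    have gxz := hgap x hx z hz hxz
    have gzx := hgap z hz x hx hxz.symm
    have gyz := hgap y hy z hz hyz
    have gzy := hgap z hz y hy hyz.symm
    rcases le_total (vecHt (P.logEmb (Additive.ofMul x))) (vecHt (P.logEmb (Additive.ofMul y)))
      with h1 | h1 <;>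
    rcases le_total (vecHt (P.logEmb (Additive.ofMul x))) (vecHt (P.logEmb (Additive.ofMul z)))
      with h2 | h2 <;>
    rcases le_total (vecHt (P.logEmb (Additive.ofMul y))) (vecHt (P.logEmb (Additive.ofMul z)))
      with h3 | h3 <;>
    simp only [h1, h2, h3, true_imp_iff] at gxy gyx gxz gzx gyz gzy <;> linarith
  have hsmall : small.card ≤ 1600001 ^ (2 * r) * 7 := by
    by_contra! hcon
    obtain ⟨t, hts, htc, htd⟩ := exists_close_subfamily hfin 800000 7 small
      (fun z => if h : z ∈ s then (⟨(200 * (P.arch.card : ℝ)⁻¹) •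
        P.logEmb (Additive.ofMul z), E.smul_mem _ (hmem z h)⟩ : E) else 0) (by
        intro z hz
        have hz' := Finset.mem_filter.1 hz
        have hpos : (0 : ℝ) < P.arch.card := by linarith
        rw [dif_pos hz'.1, Submodule.coe_norm, norm_smul, Real.norm_of_nonneg (by positivity)]
        have := hnorm z hz'.1
        have h2 := not_le.1 hz'.2
        rw [mul_assoc, inv_mul_eq_div]
        have h4 : ‖P.logEmb (Additive.ofMul z)‖ / (P.arch.card : ℝ) ≤ 4000 := by
          rw [div_le_iff₀ hpos]; linarith
        push_cast; linarith) (by norm_num; exact hcon)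
    obtain ⟨x, hx, y, hy, z, hz, hne⟩ := exists_not_collinear t
      (fun z hz => hsol z (Finset.mem_filter.1 (hts hz)).1) htc
    have hx' := Finset.mem_filter.1 (hts hx)
    have hcl' : ∀ y ∈ t, vecHt (P.logEmb (Additive.ofMul y) - P.logEmb (Additive.ofMul x)) ≤
        P.arch.card / 100 := by
      intro y hy
      have hy' := Finset.mem_filter.1 (hts hy)
      refine (vecHt_le_norm _).trans ?_
      have h := htd y hy x hx
      rw [dif_pos hx'.1, dif_pos hy'.1, Submodule.coe_norm] at h
      simp only [AddSubgroupClass.coe_sub] at h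
      rw [← smul_sub, norm_smul, Real.norm_of_nonneg (by positivity), mul_assoc, inv_mul_eq_div]
        at h
      have h5 : ‖P.logEmb (Additive.ofMul y) - P.logEmb (Additive.ofMul x)‖ / (P.arch.card : ℝ) <
          1 / 100 := by linarith
      rw [div_lt_iff₀ (by linarith)] at h5
      linarith
    have h := (hsol x hx'.1).card_mul_log_le (hsol y (Finset.mem_filter.1 (hts hy)).1)
      (hsol z (Finset.mem_filter.1 (hts hz)).1) hne
    have h1 := hcl' y hy
    have h2 := hcl' z hz
    have hlog : 1 / 7 ≤ Real.log (7 / 6) := by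
      have := Real.one_sub_inv_le_log_of_pos (x := 7 / 6) (by norm_num)
      norm_num at this ⊢
      linarith
    nlinarith
  unfold unitBound
  omega

end PlaceSystem

namespace PlaceSystem

open NumberField

variable (L : Type*) [Field L] [NumberField L]

/-- The place system of a number field attached to a finite set of finite places. -/
def ofNumberField (S : Finset (FinitePlace L)) :
    PlaceSystem L ((Σ w : InfinitePlace L, Fin w.mult) ⊕ S) where
  v := Sum.elim (fun w => w.1.val) (fun w => w.1.val)
  arch := Finset.univ.map ⟨Sum.inl, Sum.inl_injective⟩
  isNonarchimedean := by
    rintro (w | w) hw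
    · simp at hw
    · exact FinitePlace.add_le w.1
  arch_natCast := by
    rintro (w | w) hw n
    · exact InfinitePlace.map_natCast w.1 n
    · simp at hw
  arch_nonempty := by
    obtain ⟨w⟩ : Nonempty (InfinitePlace L) := inferInstance
    exact ⟨Sum.inl ⟨w, ⟨0, w.mult_pos⟩⟩, by simp⟩
  O :=
    { carrier := {x | ∀ v ∉ S, v x ≤ 1}
      mul_mem' := fun {a b} ha hb v hv => by
        rw [map_mul]; exact mul_le_one₀ (ha v hv) (apply_nonneg v b) (hb v hv)
      one_mem' := fun v _ => by simp
      add_mem' := fun {a b} ha hb v hv =>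
        (FinitePlace.add_le v a b).trans (max_le (ha v hv) (hb v hv))
      zero_mem' := fun v _ => by simp
      neg_mem' := fun {a} ha v hv => by
        rw [show v (-a) = v.val (-a) from rfl, AbsoluteValue.map_neg]; exact ha v hv }
  sum_log_nonneg := by
    classical
    intro τ hτ h0
    have hv0 : ∀ v : FinitePlace L, 0 < v τ := fun v => v.val.pos h0
    have hw0 : ∀ w : InfinitePlace L, 0 < w τ := fun w => w.val.pos h0
    have hfin : (Function.mulSupport fun v : FinitePlace L => v τ).Finite :=
      FinitePlace.hasFiniteMulSupport h0
    have hprod := prod_abs_eq_one h0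
    have hle : ∏ᶠ v : FinitePlace L, v τ ≤ ∏ v ∈ S, v τ := by
      rw [finprod_eq_prod_of_mulSupport_subset (s := hfin.toFinset ∪ S) _
        (fun x hx => by
          rw [Finset.coe_union, Set.Finite.coe_toFinset]
          exact Or.inl hx),
        ← Finset.prod_sdiff (Finset.subset_union_right : S ⊆ hfin.toFinset ∪ S)]
      refine mul_le_of_le_one_left (Finset.prod_nonneg fun v _ => (hv0 v).le) ?_
      exact Finset.prod_le_one (fun v _ => (hv0 v).le)
        fun v hv => hτ v (Finset.mem_sdiff.1 hv).2
    have hpos : 0 < ∏ w : InfinitePlace L, w τ ^ w.mult :=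
      Finset.prod_pos fun w _ => pow_pos (hw0 w) _
    have h1 : 1 ≤ (∏ w : InfinitePlace L, w τ ^ w.mult) * ∏ v ∈ S, v τ := by
      rw [← hprod]; exact mul_le_mul_of_nonneg_left hle hpos.le
    have h2 := Real.log_nonneg h1
    rw [Real.log_mul hpos.ne' (Finset.prod_pos fun v _ => hv0 v).ne',
      Real.log_prod (fun w _ => (pow_pos (hw0 w) _).ne'),
      Real.log_prod (fun v _ => (hv0 v).ne')] at h2
    refine h2.trans (le_of_eq ?_)
    rw [Fintype.sum_sum_type, Fintype.sum_sigma]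
    congr 1
    · refine Finset.sum_congr rfl fun w _ => ?_
      simp only [Sum.elim_inl, Finset.sum_const, Finset.card_univ, Fintype.card_fin, nsmul_eq_mul,
        Real.log_pow]
      rfl
    · exact (Finset.sum_coe_sort S (fun v => Real.log (v τ))).symm

end PlaceSystem

open NumberField in
/-- The number of solutions of the unit equation in a subgroup of the multiplicative group of a
number field generated by `r` elements is bounded in terms of `r` only. -/
theorem NumberField.card_unit_solutions_le {L : Type*} [Field L] [NumberField L] {r : ℕ}
    (g : Fin r → Lˣ) (s : Finset (Lˣ × Lˣ))
    (hs : ∀ z ∈ s, z.1 ∈ Subgroup.closure (Set.range g) ∧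
      z.2 ∈ Subgroup.closure (Set.range g) ∧ (z.1 : L) + z.2 = 1) :
    s.card ≤ PlaceSystem.unitBound r := by
  have hfin : (⋃ k, {v : FinitePlace L | v (g k : L) ≠ 1}).Finite :=
    Set.finite_iUnion fun k => FinitePlace.hasFiniteMulSupport (g k).ne_zero
  refine (PlaceSystem.ofNumberField L hfin.toFinset).card_solutions_le g (fun k => ?_) s hs
  have h1 : ∀ v : FinitePlace L, v ∉ hfin.toFinset → v (g k : L) = 1 := by
    intro v hv
    by_contra h
    exact hv (hfin.mem_toFinset.2 (Set.mem_iUnion.2 ⟨k, h⟩))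
  refine ⟨fun v hv => (h1 v hv).le, fun v hv => ?_⟩
  rw [Units.val_inv_eq_inv_val, map_inv₀, h1 v hv, inv_one]

/-- A nontrivial finitely generated `ℚ`-algebra maps to a number field. -/
theorem exists_ringHom_numberField {A : Type*} [CommRing A] [Nontrivial A] [Algebra ℚ A]
    [Algebra.FiniteType ℚ A] :
    ∃ (m : Ideal A) (_ : m.IsMaximal), @NumberField (A ⧸ m) (Ideal.Quotient.field m) := by
  obtain ⟨m, hm⟩ := Ideal.exists_maximal A
  let : Field (A ⧸ m) := Ideal.Quotient.field m
  let alg : Algebra ℚ (A ⧸ m) := Ideal.Quotient.algebra ℚ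
  have : CharZero (A ⧸ m) := algebraRat.charZero _
  have : Algebra.FiniteType ℚ (A ⧸ m) :=
    Algebra.FiniteType.of_surjective (Ideal.Quotient.mkₐ ℚ m) (Ideal.Quotient.mkₐ_surjective ℚ m)
  have hfin : @Module.Finite ℚ (A ⧸ m) _ _ (@Algebra.toModule _ _ _ _ alg) :=
    finite_of_finite_type_of_isJacobsonRing ℚ (A ⧸ m)
  refine ⟨m, hm, { to_charZero := inferInstance, to_finiteDimensional := ?_ }⟩
  exact (Subsingleton.elim alg DivisionRing.toRatAlgebra) ▸ hfin

theorem card_unit_solutions_le {K : Type*} [Field K] [CharZero K] {r : ℕ}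
    (g : Fin r → Kˣ) (s : Finset (Kˣ × Kˣ))
    (hs : ∀ z ∈ s, z.1 ∈ Subgroup.closure (Set.range g) ∧
      z.2 ∈ Subgroup.closure (Set.range g) ∧ (z.1 : K) + z.2 = 1) :
    s.card ≤ PlaceSystem.unitBound r := by
  classical
  set T : Finset K := Finset.univ.image (fun k => (g k : K)) ∪
    Finset.univ.image (fun k => ((g k)⁻¹ : K)) ∪
    (s ×ˢ s).image (fun p => ((p.1.1 : K) - p.2.1)⁻¹) with hT
  set A := Algebra.adjoin ℚ (T : Set K) with hA
  have hTA : ∀ x ∈ T, x ∈ A := fun x hx => Algebra.subset_adjoin hx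
  have : Algebra.FiniteType ℚ A := A.fg_iff_finiteType.1 (Subalgebra.fg_adjoin_finset T)
  have hg1 : ∀ k, (g k : K) ∈ A := fun k => hTA _ (by simp [hT])
  have hg2 : ∀ k, ((g k)⁻¹ : K) ∈ A := fun k => hTA _ (by simp [hT])
  have hdiff : ∀ z ∈ s, ∀ w ∈ s, ((z.1 : K) - w.1)⁻¹ ∈ A := fun z hz w hw =>
    hTA _ (Finset.mem_union_right _ (Finset.mem_image.2 ⟨(z, w), by simp [hz, hw], rfl⟩))
  let gA : Fin r → Aˣ := fun k => ⟨⟨g k, hg1 k⟩, ⟨(g k)⁻¹, hg2 k⟩,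
    Subtype.ext (by simp), Subtype.ext (by simp)⟩
  obtain ⟨m, hm, hnf⟩ := exists_ringHom_numberField (A := A)
  let : Field (A ⧸ m) := Ideal.Quotient.field m
  let φ : A →+* A ⧸ m := Ideal.Quotient.mk m
  have hmap : (Subgroup.closure (Set.range gA)).map (Units.map A.val.toRingHom.toMonoidHom) =
      Subgroup.closure (Set.range g) := by
    rw [MonoidHom.map_closure, ← Set.range_comp]
    congr 2
    exact funext fun k => Units.ext rfl
  have lift : ∀ u ∈ Subgroup.closure (Set.range g), ∃ v ∈ Subgroup.closure (Set.range gA),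
      ((v : A) : K) = u := by
    intro u hu
    rw [← hmap] at hu
    obtain ⟨v, hv, rfl⟩ := hu
    exact ⟨v, hv, rfl⟩
  choose! ℓ hℓ hℓ' using lift
  let ψ : Kˣ × Kˣ → (A ⧸ m)ˣ × (A ⧸ m)ˣ := fun z =>
    (Units.map φ.toMonoidHom (ℓ z.1), Units.map φ.toMonoidHom (ℓ z.2))
  have hψ : Set.InjOn ψ s := by
    intro z hz w hw h
    have h1 : φ (ℓ z.1 : A) = φ (ℓ w.1 : A) := congrArg (fun p => (p.1 : A ⧸ m)) h
    have h2 : (z.1 : K) = w.1 := by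
      by_contra hne
      have h3 : ((ℓ z.1 : A) - (ℓ w.1 : A)) * ⟨_, hdiff z hz w hw⟩ = 1 := by
        apply Subtype.ext
        simp only [MulMemClass.coe_mul, AddSubgroupClass.coe_sub, OneMemClass.coe_one]
        rw [hℓ' _ (hs z hz).1, hℓ' _ (hs w hw).1]
        exact mul_inv_cancel₀ (sub_ne_zero.2 hne)
      have h4 := congrArg φ h3
      rw [map_mul, map_sub, h1, sub_self, zero_mul, map_one] at h4
      exact zero_ne_one h4
    refine Prod.ext (Units.ext h2) (Units.ext ?_)
    linear_combination (hs z hz).2.2 - (hs w hw).2.2 - h2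
  rw [← Finset.card_image_of_injOn hψ]
  refine NumberField.card_unit_solutions_le (fun k => Units.map φ.toMonoidHom (gA k)) _ ?_
  intro z hz
  obtain ⟨w, hw, rfl⟩ := Finset.mem_image.1 hz
  have hcl : ∀ u ∈ Subgroup.closure (Set.range g), Units.map φ.toMonoidHom (ℓ u) ∈
      Subgroup.closure (Set.range fun k => Units.map φ.toMonoidHom (gA k)) := by
    intro u hu
    have := Subgroup.mem_map_of_mem (Units.map φ.toMonoidHom) (hℓ u hu)
    rwa [MonoidHom.map_closure, ← Set.range_comp] at this
  refine ⟨hcl _ (hs w hw).1, hcl _ (hs w hw).2.1, ?_⟩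
  have h3 : (ℓ w.1 : A) + (ℓ w.2 : A) = 1 := by
    apply Subtype.ext
    simp only [AddMemClass.coe_add, OneMemClass.coe_one]
    rw [hℓ' _ (hs w hw).1, hℓ' _ (hs w hw).2.1, (hs w hw).2.2]
  have h4 := congrArg φ h3
  rwa [map_add, map_one] at h4

/-- The unit equation `x + y = 1` has finitely many solutions in a finitely generated subgroup of
the multiplicative group of a field of characteristic zero. -/
theorem finite_unit_solutions {K : Type*} [Field K] [CharZero K] (Γ : Subgroup Kˣ) (hΓ : Γ.FG) :
    {z : Kˣ × Kˣ | z.1 ∈ Γ ∧ z.2 ∈ Γ ∧ (z.1 : K) + z.2 = 1}.Finite := by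
  obtain ⟨S, hS⟩ := hΓ
  have hr : Set.range (fun k : Fin S.card => ((S.equivFin.symm k : S) : Kˣ)) = S := by
    rw [show (fun k : Fin S.card => ((S.equivFin.symm k : S) : Kˣ)) =
      Subtype.val ∘ S.equivFin.symm from rfl, Set.range_comp, S.equivFin.symm.range_eq_univ]
    simp
  by_contra hinf
  obtain ⟨t, ht, hcard⟩ := Set.Infinite.exists_subset_card_eq hinf
    (PlaceSystem.unitBound S.card + 1)
  have := card_unit_solutions_le _ t (fun z hz => by
    have h := ht hz
    rw [← hS, ← hr] at h
    exact h)
  omega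

section fgSubgroup

variable {G G' : Type*} [CommGroup G] [CommGroup G']

theorem Subgroup.fg_iff_toIntSubmodule_fg (H : Subgroup G) :
    H.FG ↔ (AddSubgroup.toIntSubmodule (Subgroup.toAddSubgroup H)).FG := by
  rw [Subgroup.fg_iff_add_fg, Submodule.fg_iff_addSubgroup_fg]
  rfl

theorem Subgroup.FG.of_le {H H' : Subgroup G} (h : H'.FG) (hle : H ≤ H') : H.FG := by
  rw [Subgroup.fg_iff_toIntSubmodule_fg] at h ⊢
  have : Module.Finite ℤ (AddSubgroup.toIntSubmodule (Subgroup.toAddSubgroup H')) :=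
    Module.Finite.iff_fg.2 h
  have : IsNoetherian ℤ (AddSubgroup.toIntSubmodule (Subgroup.toAddSubgroup H')) :=
    isNoetherian_of_isNoetherianRing_of_finite _ _
  exact isNoetherian_submodule.1 this _ hle

theorem Subgroup.FG.of_map_of_inf_ker (f : G →* G') {H : Subgroup G} (h : (H.map f).FG)
    (h' : (H ⊓ f.ker).FG) : H.FG := by
  rw [Subgroup.fg_iff_toIntSubmodule_fg] at h h' ⊢
  exact Submodule.fg_of_fg_map_of_fg_inf_ker f.toAdditive.toIntLinearMap h h'

theorem Subgroup.fg_of_group_fg [Group.FG G] (H : Subgroup G) : H.FG :=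
  Subgroup.FG.of_le (Group.fg_def.1 ‹_›) le_top

end fgSubgroup

section Dedekind

open IsDedekindDomain

/-- A group of units of a finitely generated subring of the fraction field of a Dedekind domain is
finitely generated if the subgroup of units of the Dedekind domain in it is. -/
theorem fg_of_fg_inf_units_range (D : Type*) {K : Type*} [CommRing D] [IsDedekindDomain D]
    [Field K] [Algebra D K] [IsFractionRing D K] (s : Finset K) (H : Subgroup Kˣ)
    (hH : H ≤ (Subring.closure (s : Set K)).toSubmonoid.units)
    (hfg : (H ⊓ (algebraMap D K).range.toSubmonoid.units).FG) : H.FG := by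
  classical
  set S : Set (HeightOneSpectrum D) := ⋃ x ∈ s, HeightOneSpectrum.Support D x with hS
  have hSfin : S.Finite := s.finite_toSet.biUnion fun x _ => HeightOneSpectrum.Support.finite D x
  have : Finite S := hSfin
  have hle : ∀ v ∉ S, ∀ x ∈ Subring.closure (s : Set K), v.valuation K x ≤ 1 := by
    intro v hv x hx
    have : Subring.closure (s : Set K) ≤ (v.valuation K).integer := by
      rw [Subring.closure_le]
      intro y hy
      by_contra h
      refine hv (Set.mem_biUnion hy ?_)
      exact not_le.1 fun hle => h ((Valuation.mem_integer_iff _ _).2 hle)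
    exact this hx
  let f : Kˣ →* (S → Multiplicative ℤ) :=
    MonoidHom.pi fun v => HeightOneSpectrum.valuationOfNeZero v.1
  have hfgS : Group.FG (S → Multiplicative ℤ) := inferInstance
  refine Subgroup.FG.of_map_of_inf_ker f (Subgroup.fg_of_group_fg _) (hfg.of_le ?_)
  refine le_inf inf_le_left fun u hu => ?_
  have hu1 := (Submonoid.mem_units_iff _ _).1 (hH hu.1)
  have hval : ∀ v : HeightOneSpectrum D, v.valuation K (u : K) = 1 := by
    intro v
    by_cases hv : v ∈ S
    · rw [← HeightOneSpectrum.valuationOfNeZero_eq, show v.valuationOfNeZero u = 1 from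
        congrFun (MonoidHom.mem_ker.1 hu.2) ⟨v, hv⟩, WithZero.coe_one]
    · refine le_antisymm (hle v hv _ hu1.1) ?_
      have h := hle v hv _ hu1.2
      rw [Units.val_inv_eq_inv_val, map_inv₀] at h
      exact (inv_le_one₀ (zero_lt_iff.2 ((Valuation.ne_zero_iff _).2 u.ne_zero))).1 h
  refine (Submonoid.mem_units_iff _ _).2 ⟨?_, ?_⟩
  · exact HeightOneSpectrum.mem_integers_of_valuation_le_one K _ fun v => (hval v).le
  · refine HeightOneSpectrum.mem_integers_of_valuation_le_one K _ fun v => ?_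
    rw [Units.val_inv_eq_inv_val, map_inv₀, hval v, inv_one]

end Dedekind

open NumberField in
theorem NumberField.fg_units_closure {K : Type*} [Field K] [NumberField K] (s : Finset K) :
    (Subring.closure (s : Set K)).toSubmonoid.units.FG := by
  refine fg_of_fg_inf_units_range (𝓞 K) s _ le_rfl (Subgroup.FG.of_le ?_ inf_le_right)
  have h1 : Group.FG (𝓞 K)ˣ := by
    rw [GroupFG.iff_add_fg, ← Module.Finite.iff_addGroup_fg]
    infer_instance
  have h2 : Group.FG (Units.map (algebraMap (𝓞 K) K).toMonoidHom).range := inferInstance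
  refine ((Group.fg_iff_subgroup_fg _).1 h2).of_le fun u hu => ?_
  obtain ⟨⟨a, ha⟩, ⟨b, hb⟩⟩ := (Submonoid.mem_units_iff _ _).1 hu
  have hinj := FaithfulSMul.algebraMap_injective (𝓞 K) K
  refine ⟨⟨a, b, hinj ?_, hinj ?_⟩, Units.ext ha⟩
  · rw [map_mul, ha, hb]; simp
  · rw [map_mul, ha, hb]; simp

section adjoin

variable {k E : Type*} [Field k] [Field E] [Algebra k E]

theorem isPrincipalIdealRing_adjoin_singleton (x : E) :
    IsPrincipalIdealRing (Algebra.adjoin k {x}) := by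
  have h : Algebra.adjoin k {x} = (Polynomial.aeval x : Polynomial k →ₐ[k] E).range :=
    Algebra.adjoin_singleton_eq_range_aeval k x
  rw [h]
  exact IsPrincipalIdealRing.of_surjective _
    (AlgHom.rangeRestrict_surjective (Polynomial.aeval x : Polynomial k →ₐ[k] E))

theorem isFractionRing_adjoin (S : Set E) (h : IntermediateField.adjoin k S = ⊤) :
    IsFractionRing (Algebra.adjoin k S) E := by
  refine IsFractionRing.of_field _ _ fun z => ?_
  have hz : z ∈ IntermediateField.adjoin k S := by rw [h]; trivial
  obtain ⟨a, ha, b, hb, rfl⟩ := IntermediateField.mem_adjoin_iff_div.1 hz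
  exact ⟨⟨a, ha⟩, ⟨b, hb⟩, rfl⟩

end adjoin

section Roquette

variable {k E K : Type*} [Field k] [Field E] [Field K] [Algebra k E] [Algebra E K] [Algebra k K]
  [IsScalarTower k E K]

theorem isIntegral_of_isIntegral_adjoin_inv (x : E) {u : K}
    (h : IsIntegral (Algebra.adjoin k {x}) u) (h' : IsIntegral (Algebra.adjoin k {x⁻¹}) u) :
    IsIntegral k u := by
  by_contra hu
  have hu' : u ∉ (integralClosure k K).toSubring := hu
  obtain ⟨V, hV, huV⟩ := Subring.exists_le_valuationSubring_of_isIntegrallyClosedIn hu'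
  have key : ∀ y : E, algebraMap E K y ∈ V → IsIntegral (Algebra.adjoin k {y}) u → False := by
    intro y hy h_int
    have hle : ∀ a ∈ Algebra.adjoin k {y}, algebraMap E K a ∈ V.toSubring := by
      intro a ha
      induction ha using Algebra.adjoin_induction with
      | mem z hz => rw [Set.mem_singleton_iff.1 hz]; exact hy
      | algebraMap r =>
        rw [← IsScalarTower.algebraMap_apply]
        exact hV (integralClosure k K |>.algebraMap_mem r)
      | add a b _ _ ha hb => rw [map_add]; exact add_mem ha hb
      | mul a b _ _ ha hb => rw [map_mul]; exact mul_mem ha hb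
    let φ : Algebra.adjoin k {y} →+* V.toSubring :=
      ((algebraMap E K).comp (Algebra.adjoin k {y}).val.toRingHom).codRestrict V.toSubring
        fun a => hle a a.2
    have h1 : IsIntegral V.toSubring (RingHom.id K u) :=
      h_int.map_of_comp_eq φ (RingHom.id K) (RingHom.ext fun a => rfl)
    have : IsIntegrallyClosedIn V.toSubring K := inferInstanceAs (IsIntegrallyClosedIn V K)
    exact huV (Subring.isIntegrallyClosedIn_iff.1 this h1)
  rcases V.mem_or_inv_mem (algebraMap E K x) with hx | hx
  · exact key x hx h
  · exact key x⁻¹ (by rwa [map_inv₀]) h'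

theorem fg_of_fg_inf_isIntegral [CharZero k] [FiniteDimensional E K] (x : E)
    (hx : IntermediateField.adjoin k {x} = ⊤) (s : Finset K) (H : Subgroup Kˣ)
    (hH : H ≤ (Subring.closure (s : Set K)).toSubmonoid.units)
    (hfg : ∀ H' : Subgroup Kˣ, H' ≤ H → (∀ u ∈ H', IsIntegral k (u : K)) → H'.FG) : H.FG := by
  have step : ∀ (y : E), IntermediateField.adjoin k {y} = ⊤ → ∀ H : Subgroup Kˣ,
      H ≤ (Subring.closure (s : Set K)).toSubmonoid.units →
      (∀ H' : Subgroup Kˣ, H' ≤ H → (∀ u ∈ H', IsIntegral (Algebra.adjoin k {y}) (u : K)) →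
        H'.FG) → H.FG := by
    intro y hy H hH h
    have := isPrincipalIdealRing_adjoin_singleton (k := k) y
    have := isFractionRing_adjoin _ hy
    have : CharZero E := charZero_of_injective_algebraMap (algebraMap k E).injective
    have := integralClosure.isDedekindDomain (Algebra.adjoin k {y}) E K
    have := integralClosure.isFractionRing_of_finite_extension (A := Algebra.adjoin k {y}) E K
    refine fg_of_fg_inf_units_range (integralClosure (Algebra.adjoin k {y}) K) s H hH
      (h _ inf_le_left fun u hu => ?_)
    obtain ⟨⟨a, ha⟩, -⟩ := (Submonoid.mem_units_iff _ _).1 hu.2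
    rw [← ha]
    exact a.2
  have hx' : IntermediateField.adjoin k {x⁻¹} = ⊤ := by
    rw [eq_top_iff, ← hx, IntermediateField.adjoin_simple_le_iff]
    simpa using inv_mem (IntermediateField.mem_adjoin_simple_self k x⁻¹)
  refine step x hx H hH fun H₁ hH₁ h₁ => step x⁻¹ hx' H₁ (hH₁.trans hH) fun H₂ hH₂ h₂ => ?_
  exact hfg H₂ (hH₂.trans hH₁) fun u hu => isIntegral_of_isIntegral_adjoin_inv x (h₁ u (hH₂ hu))
    (h₂ u hu)

end Roquette

section Roquette

variable {k K : Type} [Field k] [Field K] [Algebra k K]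

theorem fg_of_isIntegral
    (hk : ∀ (L : Type) [Field L] [Algebra k L] [FiniteDimensional k L] (s : Finset L),
      (Subring.closure (s : Set L)).toSubmonoid.units.FG) (s : Finset K) (H : Subgroup Kˣ)
    (hH : H ≤ (Subring.closure (s : Set K)).toSubmonoid.units)
    (h_int : ∀ u ∈ H, IsIntegral k (u : K)) : H.FG := by
  classical
  let B := Algebra.adjoin k (s : Set K)
  have : Algebra.FiniteType k B := B.fg_iff_finiteType.1 (Subalgebra.fg_adjoin_finset s)
  obtain ⟨m, hm⟩ := Ideal.exists_maximal B
  let : Field (B ⧸ m) := Ideal.Quotient.field m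
  have : Algebra.FiniteType k (B ⧸ m) :=
    Algebra.FiniteType.of_surjective (Ideal.Quotient.mkₐ k m) (Ideal.Quotient.mkₐ_surjective k m)
  have hfin : Module.Finite k (B ⧸ m) := finite_of_finite_type_of_isJacobsonRing k (B ⧸ m)
  let φ : B →+* B ⧸ m := Ideal.Quotient.mk m
  let sB : Finset B := s.attach.image fun x => ⟨x.1, Algebra.subset_adjoin x.2⟩
  have hsB : (Subring.closure (sB : Set B)).map B.val.toRingHom = Subring.closure (s : Set K) := by
    rw [RingHom.map_closure]
    congr 1
    ext x
    simpa [sB] using fun h => (Algebra.subset_adjoin h : x ∈ B)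
  have hlift : ∀ x ∈ Subring.closure (s : Set K), ∃ b ∈ Subring.closure (sB : Set B),
      (b : K) = x := by
    intro x hx
    rw [← hsB] at hx
    obtain ⟨b, hb, rfl⟩ := hx
    exact ⟨b, hb, rfl⟩
  have hmem : ∀ u : H, ∃ v : Bˣ, v ∈ (Subring.closure (sB : Set B)).toSubmonoid.units ∧
      ((v : B) : K) = (u : Kˣ) := by
    intro u
    obtain ⟨h1, h2⟩ := (Submonoid.mem_units_iff _ _).1 (hH u.2)
    obtain ⟨a, ha, ha'⟩ := hlift _ h1
    obtain ⟨b, hb, hb'⟩ := hlift _ h2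
    refine ⟨⟨a, b, Subtype.ext ?_, Subtype.ext ?_⟩, (Submonoid.mem_units_iff _ _).2 ⟨ha, hb⟩, ha'⟩
    · simp [ha', hb']
    · simp [ha', hb']
  choose ℓ hℓ hℓ' using hmem
  have hBK : Function.Injective (fun v : Bˣ => ((v : B) : K)) :=
    Subtype.val_injective.comp Units.val_injective
  let g : H →* Bˣ := MonoidHom.mk' ℓ fun a b => hBK (by simp [hℓ'])
  let f : H →* (B ⧸ m)ˣ := (Units.map φ.toMonoidHom).comp g
  have hf : Function.Injective f := by
    intro u w huw
    by_contra hne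
    have h1 : φ (ℓ u : B) = φ (ℓ w : B) := congrArg Units.val huw
    have h2 : ((u : Kˣ) : K) - (w : Kˣ) ≠ 0 := fun h =>
      hne (Subtype.ext (Units.ext (sub_eq_zero.1 h)))
    have h3 : (((u : Kˣ) : K) - (w : Kˣ))⁻¹ ∈ B :=
      ((h_int u u.2).sub (h_int w w.2)).inv_mem
        (by rw [← hℓ', ← hℓ']; exact sub_mem (ℓ u : B).2 (ℓ w : B).2)
    have h4 : ((ℓ u : B) - (ℓ w : B)) * ⟨_, h3⟩ = 1 := Subtype.ext (by simp [hℓ', h2])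
    have h5 := congrArg φ h4
    rw [map_mul, map_sub, h1, sub_self, zero_mul, map_one] at h5
    exact zero_ne_one h5
  have hrange : f.range.FG := by
    refine (hk (B ⧸ m) (sB.image φ)).of_le ?_
    rintro _ ⟨u, rfl⟩
    have hc : Subring.closure ((sB.image φ : Finset (B ⧸ m)) : Set (B ⧸ m)) =
        (Subring.closure (sB : Set B)).map φ := by
      rw [RingHom.map_closure, Finset.coe_image]
    rw [hc]
    obtain ⟨h1, h2⟩ := (Submonoid.mem_units_iff _ _).1 (hℓ u)
    exact (Submonoid.mem_units_iff _ _).2 ⟨⟨_, h1, rfl⟩, ⟨_, h2, rfl⟩⟩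
  have h1 : (⊤ : Subgroup H).FG := by
    refine Subgroup.FG.of_map_of_inf_ker f (by rwa [← MonoidHom.range_eq_map]) ?_
    rw [(MonoidHom.ker_eq_bot_iff f).2 hf, inf_bot_eq]
    exact ⟨∅, by simp⟩
  exact (Group.fg_iff_subgroup_fg H).1 ⟨h1⟩

end Roquette

/-- **Roquette's theorem**: the group of units of a finitely generated subring of `ℂ` is finitely
generated. -/
theorem fg_units_closure (s : Finset ℂ) :
    (Subring.closure (s : Set ℂ)).toSubmonoid.units.FG := by
  classical
  have main : ∀ (K : Type) [Field K] [Algebra (IntermediateField.adjoin ℚ (s : Set ℂ)) K]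
      [FiniteDimensional (IntermediateField.adjoin ℚ (s : Set ℂ)) K] (t : Finset K),
      (Subring.closure (t : Set K)).toSubmonoid.units.FG := by
    refine IntermediateField.induction_on_adjoin_finset s (fun k : IntermediateField ℚ ℂ =>
      ∀ (K : Type) [Field K] [Algebra k K] [FiniteDimensional k K] (t : Finset K),
        (Subring.closure (t : Set K)).toSubmonoid.units.FG) ?_ ?_
    · intro K _ _ _ t
      have : CharZero K := charZero_of_injective_algebraMap
        (algebraMap (⊥ : IntermediateField ℚ ℂ) K).injective
      have : FiniteDimensional ℚ K := FiniteDimensional.trans ℚ (⊥ : IntermediateField ℚ ℂ) K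
      have : NumberField K := { to_charZero := inferInstance, to_finiteDimensional := inferInstance }
      exact NumberField.fg_units_closure t
    · intro k x _ ih K iF iA iFD t
      let E := IntermediateField.adjoin k {x}
      let algEK : Algebra E K := iA
      have : FiniteDimensional E K := iFD
      let algkK : Algebra k K := ((algebraMap E K).comp (algebraMap k E)).toAlgebra
      have : IsScalarTower k E K := IsScalarTower.of_algebraMap_eq fun _ => rfl
      refine fg_of_fg_inf_isIntegral (k := k) (E := E) (IntermediateField.AdjoinSimple.gen k x) ?_ t _ le_rfl ?_
      · have hmap : (IntermediateField.adjoin k {IntermediateField.AdjoinSimple.gen k x}).map E.val =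
            E := by
          rw [IntermediateField.adjoin_map, Set.image_singleton]
          rfl
        refine eq_top_iff.2 fun z _ => ?_
        obtain ⟨w, hw, hwz⟩ : (z : ℂ) ∈
            (IntermediateField.adjoin k {IntermediateField.AdjoinSimple.gen k x}).map E.val := by
          rw [hmap]
          exact z.2
        rwa [← Subtype.ext (hwz : (w : ℂ) = z)]
      · intro H' hH' h_int
        exact fg_of_isIntegral (k := k) ih t H' hH' h_int
  let L := IntermediateField.adjoin ℚ (s : Set ℂ)
  let sL : Finset L := s.attach.image fun x => ⟨x.1, IntermediateField.subset_adjoin _ _ x.2⟩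
  have h1 := main L sL
  have hsL : (Subring.closure (sL : Set L)).map L.val.toRingHom = Subring.closure (s : Set ℂ) := by
    rw [RingHom.map_closure]
    congr 1
    ext x
    simpa [sL] using fun h => IntermediateField.subset_adjoin ℚ (s : Set ℂ) h
  have h2 : ((Subring.closure (sL : Set L)).toSubmonoid.units.map
      (Units.map L.val.toRingHom.toMonoidHom)).FG := by
    obtain ⟨S, hS⟩ := h1
    exact ⟨S.image _, by rw [Finset.coe_image, ← MonoidHom.map_closure, hS]⟩
  refine h2.of_le fun u hu => ?_
  obtain ⟨ha, hb⟩ := (Submonoid.mem_units_iff _ _).1 hu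
  rw [← hsL] at ha hb
  obtain ⟨a, ha, ha'⟩ := ha
  obtain ⟨b, hb, hb'⟩ := hb
  have hinj : Function.Injective L.val.toRingHom := L.val.injective
  refine ⟨⟨a, b, hinj ?_, hinj ?_⟩, (Submonoid.mem_units_iff _ _).2 ⟨ha, hb⟩, Units.ext ha'⟩
  · rw [map_mul, ha', hb']; simp
  · rw [map_mul, ha', hb']; simp

section Hessian

variable {m : ℕ} {S : Type*} [CommRing S]

/-- The Hessian determinant of a polynomial, as a polynomial. -/
def hessDet (P : MvPolynomial (Fin m) S) : MvPolynomial (Fin m) S :=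
  (Matrix.of fun i j => pderiv i (pderiv j P)).det

theorem matAct_X (T : Matrix (Fin m) (Fin m) S) (i : Fin m) :
    matAct T (X i) = ∑ j, C (T i j) * X j := bind₁_X_right _ _

theorem matAct_C (T : Matrix (Fin m) (Fin m) S) (a : S) : matAct T (C a) = C a :=
  bind₁_C_right _ _

theorem matAct_add (T : Matrix (Fin m) (Fin m) S) (P Q : MvPolynomial (Fin m) S) :
    matAct T (P + Q) = matAct T P + matAct T Q := map_add _ _ _

theorem matAct_mul (T : Matrix (Fin m) (Fin m) S) (P Q : MvPolynomial (Fin m) S) :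
    matAct T (P * Q) = matAct T P * matAct T Q := map_mul _ _ _

theorem matAct_matAct (T U : Matrix (Fin m) (Fin m) S) (P : MvPolynomial (Fin m) S) :
    matAct U (matAct T P) = matAct (T * U) P := by
  unfold matAct
  rw [bind₁_bind₁]
  congr 2
  funext i
  simp only [map_sum, map_mul, algHom_C, bind₁_X_right, Matrix.mul_apply, Finset.mul_sum,
    Finset.sum_mul, algebraMap_eq]
  rw [Finset.sum_comm]
  simp [mul_assoc]

theorem map_matAct {S' : Type*} [CommRing S'] (f : S →+* S') (T : Matrix (Fin m) (Fin m) S)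
    (P : MvPolynomial (Fin m) S) : (matAct T P).map f = matAct (T.map f) (P.map f) := by
  unfold matAct
  rw [map_bind₁]
  simp

theorem eval_matAct (T : Matrix (Fin m) (Fin m) S) (P : MvPolynomial (Fin m) S) (x : Fin m → S) :
    eval x (matAct T P) = eval (T.mulVec x) P := by
  have h : (eval x).comp (bind₁ fun i => ∑ j, C (T i j) * X j).toRingHom = eval (T.mulVec x) :=
    ringHom_ext (fun r => by simp) fun i => by simp [Matrix.mulVec, dotProduct]
  exact congrArg (fun f : MvPolynomial (Fin m) S →+* S => f P) h

theorem pderiv_matAct (T : Matrix (Fin m) (Fin m) S) (P : MvPolynomial (Fin m) S) (j : Fin m) :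
    pderiv j (matAct T P) = ∑ i, C (T i j) * matAct T (pderiv i P) := by
  induction P using MvPolynomial.induction_on with
  | C a => simp [matAct]
  | add P Q hP hQ =>
    simp only [map_add, matAct_add, hP, hQ, mul_add, Finset.sum_add_distrib]
  | mul_X P k hP =>
    have h1 : pderiv j (matAct T (X k)) = C (T k j) := by
      simp [matAct_X, pderiv_X, Pi.single_apply]
    have h2 : ∀ i, matAct T (pderiv i (P * X k)) =
        matAct T P * (if k = i then 1 else 0) + matAct T (X k) * matAct T (pderiv i P) := by
      intro i
      rw [Derivation.leibniz, matAct_add, smul_eq_mul, smul_eq_mul, matAct_mul, matAct_mul,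
        pderiv_X, Pi.single_apply]
      congr 2
      split_ifs <;> simp_all [matAct]
    rw [matAct_mul, Derivation.leibniz, smul_eq_mul, smul_eq_mul, h1, hP]
    simp only [h2, mul_add, Finset.sum_add_distrib, mul_ite, mul_one, mul_zero,
      Finset.sum_ite_eq, Finset.mem_univ, if_true, Finset.mul_sum]
    congr 1
    · ring
    · exact Finset.sum_congr rfl fun i _ => by ring

theorem hessDet_matAct (T : Matrix (Fin m) (Fin m) S) (P : MvPolynomial (Fin m) S) :
    hessDet (matAct T P) = C (T.det ^ 2) * matAct T (hessDet P) := by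
  have h : (Matrix.of fun i j => pderiv i (pderiv j (matAct T P))) =
      (T.map C).transpose * (Matrix.of fun i j => pderiv i (pderiv j P)).map (matAct T) *
        T.map C := by
    refine Matrix.ext fun i j => ?_
    simp only [Matrix.of_apply, Matrix.mul_apply, Matrix.transpose_apply, Matrix.map_apply,
      pderiv_matAct, map_sum, Finset.sum_mul]
    refine Finset.sum_congr rfl fun k _ => ?_
    simp only [Derivation.leibniz, pderiv_C, mul_zero, add_zero, smul_eq_mul, pderiv_matAct,
      Finset.mul_sum]
    exact Finset.sum_congr rfl fun l _ => by ring
  have h1 : ∀ M : Matrix (Fin m) (Fin m) (MvPolynomial (Fin m) S),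
      (M.map (matAct T)).det = matAct T M.det := fun M =>
    ((bind₁ fun i => ∑ j, C (T i j) * X j : MvPolynomial (Fin m) S →ₐ[S] _).map_det M).symm
  have h2 : (T.map C : Matrix (Fin m) (Fin m) (MvPolynomial (Fin m) S)).det = C T.det :=
    (RingHom.map_det C T).symm
  unfold hessDet
  rw [h, Matrix.det_mul, Matrix.det_mul, Matrix.det_transpose, h1, h2, C_pow]
  ring

end Hessian

section NormalForm

/-- The ternary cubic form `a x³ + x² (b y + c z) + d y³ + z³`. -/
def cubicNF {S : Type*} [CommRing S] (a b c d : S) : MvPolynomial (Fin 3) S :=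
  C a * X 0 ^ 3 + X 0 ^ 2 * (C b * X 1 + C c * X 2) + (C d * X 1 ^ 3 + X 2 ^ 3)

variable {S : Type*} [CommRing S] (a b c d : S)

theorem pderiv_cubicNF :
    pderiv 0 (cubicNF a b c d) = 3 * C a * X 0 ^ 2 + 2 * X 0 * (C b * X 1 + C c * X 2) ∧
    pderiv 1 (cubicNF a b c d) = C b * X 0 ^ 2 + 3 * C d * X 1 ^ 2 ∧
    pderiv 2 (cubicNF a b c d) = C c * X 0 ^ 2 + 3 * X 2 ^ 2 := by
  unfold cubicNF
  refine ⟨?_, ?_, ?_⟩ <;>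
  · simp [pderiv_X, Derivation.leibniz, Derivation.leibniz_pow]
    try ring

theorem hessDet_cubicNF : hessDet (cubicNF a b c d) =
    36 * C d * X 1 * X 2 * (6 * C a * X 0 + 2 * C b * X 1 + 2 * C c * X 2)
      - 24 * C b ^ 2 * X 0 ^ 2 * X 2 - 24 * C c ^ 2 * C d * X 0 ^ 2 * X 1 := by
  obtain ⟨h0, h1, h2⟩ := pderiv_cubicNF a b c d
  unfold hessDet
  rw [Matrix.det_fin_three]
  simp only [Matrix.of_apply, h0, h1, h2]
  have hn : ∀ i, ∀ n : ℕ, pderiv i (n : MvPolynomial (Fin 3) S) = 0 := fun i n =>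
    Derivation.map_natCast _ n
  have hn2 := fun i => hn i 2
  have hn3 := fun i => hn i 3
  push_cast at hn2 hn3
  simp [pderiv_X, Derivation.leibniz, Derivation.leibniz_pow, hn2, hn3]
  ring

theorem hessDet_hessDet_cubicNF : hessDet (hessDet (cubicNF a b c d)) =
    C (995328 * (b * c * d) ^ 2) * cubicNF a b c d +
      C (13824 * (b ^ 3 * d + c ^ 3 * d ^ 2) + 93312 * (a * d) ^ 2) *
        hessDet (cubicNF a b c d) := by
  have hn : ∀ i, ∀ n : ℕ, pderiv i (n : MvPolynomial (Fin 3) S) = 0 := fun i n =>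
    Derivation.map_natCast _ n
  have hn2 := fun i => hn i 2
  have hn6 := fun i => hn i 6
  have hn24 := fun i => hn i 24
  have hn36 := fun i => hn i 36
  push_cast at hn2 hn6 hn24 hn36
  rw [hessDet_cubicNF, hessDet, Matrix.det_fin_three]
  simp [pderiv_X, Derivation.leibniz, Derivation.leibniz_pow, hn2, hn6, hn24, hn36]
  have hC1 : (C 995328 : MvPolynomial (Fin 3) S) = 995328 := map_ofNat C 995328
  have hC2 : (C 13824 : MvPolynomial (Fin 3) S) = 13824 := map_ofNat C 13824
  have hC3 : (C 93312 : MvPolynomial (Fin 3) S) = 93312 := map_ofNat C 93312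
  rw [hC1, hC2, hC3, cubicNF]
  ring

end NormalForm

theorem eval_cubicNF {S : Type*} [CommRing S] (a b c d : S) (x : Fin 3 → S) :
    eval x (cubicNF a b c d) =
      a * x 0 ^ 3 + x 0 ^ 2 * (b * x 1 + c * x 2) + (d * x 1 ^ 3 + x 2 ^ 3) := by
  simp [cubicNF]

theorem eval_hessDet_cubicNF {S : Type*} [CommRing S] (a b c d : S) (x : Fin 3 → S) :
    eval x (hessDet (cubicNF a b c d)) =
      36 * d * x 1 * x 2 * (6 * a * x 0 + 2 * b * x 1 + 2 * c * x 2)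
        - 24 * b ^ 2 * x 0 ^ 2 * x 2 - 24 * c ^ 2 * d * x 0 ^ 2 * x 1 := by
  simp [hessDet_cubicNF]

theorem smoothHyp.matAct {m : ℕ} {P : MvPolynomial (Fin m) ℂ} (h : smoothHyp P)
    {T : Matrix (Fin m) (Fin m) ℂ} (hT : T.det = 1) : smoothHyp (matAct T P) := by
  intro x hx
  have h1 : ∀ i, eval (T.mulVec x) (pderiv i P) = 0 := by
    have h2 : Matrix.vecMul (fun i => eval (T.mulVec x) (pderiv i P)) T = 0 := by
      funext j
      have := hx j
      rw [pderiv_matAct, map_sum] at this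
      simpa [eval_matAct, Matrix.vecMul, dotProduct, mul_comm] using this
    exact congrFun (Matrix.eq_zero_of_vecMul_eq_zero (by rw [hT]; exact one_ne_zero) h2)
  exact Matrix.eq_zero_of_mulVec_eq_zero (by rw [hT]; exact one_ne_zero) (h _ h1)

/-- The coefficients relating the second iterate of the Hessian determinant to the cubic form and
its Hessian determinant are invariant under unimodular substitutions. -/
theorem cubicNF_invariants {a b c a' b' c' d : ℂ} (hd : d ≠ 0) {M : Matrix (Fin 3) (Fin 3) ℂ}
    (hM : M.det = 1) (h : matAct M (cubicNF a b c d) = cubicNF a' b' c' d)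
    (hne : ¬ (a' = 0 ∧ b' = 0 ∧ c' = 0)) :
    (b' * c') ^ 2 = (b * c) ^ 2 ∧
      27 * a' ^ 2 * d + 4 * b' ^ 3 + 4 * c' ^ 3 * d =
        27 * a ^ 2 * d + 4 * b ^ 3 + 4 * c ^ 3 * d := by
  have hH : hessDet (cubicNF a' b' c' d) = matAct M (hessDet (cubicNF a b c d)) := by
    rw [← h, hessDet_matAct, hM, one_pow, C_1, one_mul]
  have hHH : hessDet (hessDet (cubicNF a' b' c' d)) =
      C (995328 * (b * c * d) ^ 2) * cubicNF a' b' c' d +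
      C (13824 * (b ^ 3 * d + c ^ 3 * d ^ 2) + 93312 * (a * d) ^ 2) *
        hessDet (cubicNF a' b' c' d) := by
    rw [hH, hessDet_matAct, hM, one_pow, C_1, one_mul, hessDet_hessDet_cubicNF, matAct_add,
      matAct_mul, matAct_mul, matAct_C, matAct_C, h]
  rw [hessDet_hessDet_cubicNF] at hHH
  have key := fun x => congrArg (eval x) hHH
  simp only [map_add, map_mul, eval_C, eval_cubicNF, eval_hessDet_cubicNF] at key
  have hA : (b' * c') ^ 2 = (b * c) ^ 2 := by
    have h1 := key ![0, 0, 1]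
    simp at h1
    have h2 : d ^ 2 * ((b' * c') ^ 2 - (b * c) ^ 2) = 0 := by linear_combination h1
    exact sub_eq_zero.1 ((mul_eq_zero.1 h2).resolve_left (pow_ne_zero 2 hd))
  refine ⟨hA, ?_⟩
  by_contra hB
  refine hne ?_
  have hz : ∀ x y z : ℂ, 36 * d * y * z * (6 * a' * x + 2 * b' * y + 2 * c' * z)
        - 24 * b' ^ 2 * x ^ 2 * z - 24 * c' ^ 2 * d * x ^ 2 * y = 0 := by
    intro x y z
    have h1 := key ![x, y, z]
    simp at h1
    have h2 : (d * (27 * a' ^ 2 * d + 4 * b' ^ 3 + 4 * c' ^ 3 * d -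
        (27 * a ^ 2 * d + 4 * b ^ 3 + 4 * c ^ 3 * d))) *
        (36 * d * y * z * (6 * a' * x + 2 * b' * y + 2 * c' * z)
        - 24 * b' ^ 2 * x ^ 2 * z - 24 * c' ^ 2 * d * x ^ 2 * y) = 0 := by
      linear_combination (1 / 3456) * h1 - 288 * d ^ 2 *
        (a' * x ^ 3 + x ^ 2 * (b' * y + c' * z) + (d * y ^ 3 + z ^ 3)) * hA
    exact (mul_eq_zero.1 h2).resolve_left (mul_ne_zero hd (sub_ne_zero.2 hB))
  have hb : b' = 0 := by simpa using hz 1 0 1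
  have hc : c' = 0 := by simpa [hd] using hz 1 1 0
  subst hb hc
  refine ⟨?_, rfl, rfl⟩
  simpa [hd] using hz 1 1 1

/-- `u` is a unit of the subring of `ℂ` generated by `s`. -/
def IsClosureUnit (s : Finset ℂ) (u : ℂ) : Prop :=
  u ≠ 0 ∧ u ∈ Subring.closure (s : Set ℂ) ∧ u⁻¹ ∈ Subring.closure (s : Set ℂ)

namespace IsClosureUnit

variable {s t : Finset ℂ} {u v : ℂ}

theorem mul (hu : IsClosureUnit s u) (hv : IsClosureUnit s v) : IsClosureUnit s (u * v) :=
  ⟨mul_ne_zero hu.1 hv.1, mul_mem hu.2.1 hv.2.1, by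
    rw [mul_inv]; exact mul_mem hu.2.2 hv.2.2⟩

theorem inv (hu : IsClosureUnit s u) : IsClosureUnit s u⁻¹ :=
  ⟨inv_ne_zero hu.1, hu.2.2, by rw [inv_inv]; exact hu.2.1⟩

theorem div (hu : IsClosureUnit s u) (hv : IsClosureUnit s v) : IsClosureUnit s (u / v) := by
  rw [div_eq_mul_inv]; exact hu.mul hv.inv

theorem neg (hu : IsClosureUnit s u) : IsClosureUnit s (-u) :=
  ⟨neg_ne_zero.2 hu.1, neg_mem hu.2.1, by rw [inv_neg]; exact neg_mem hu.2.2⟩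

theorem pow (hu : IsClosureUnit s u) (n : ℕ) : IsClosureUnit s (u ^ n) :=
  ⟨pow_ne_zero _ hu.1, pow_mem hu.2.1 n, by rw [← inv_pow]; exact pow_mem hu.2.2 n⟩

theorem mono (h : s ⊆ t) (hu : IsClosureUnit s u) : IsClosureUnit t u :=
  have hle := Subring.closure_mono (Finset.coe_subset.2 h)
  ⟨hu.1, hle hu.2.1, hle hu.2.2⟩

theorem of_mul_eq {w : ℂ} (hw : w ≠ 0) (h : u * v = w)
    (hu : u ∈ Subring.closure (s : Set ℂ)) (hv : v ∈ Subring.closure (s : Set ℂ))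
    (hw' : w⁻¹ ∈ Subring.closure (s : Set ℂ)) : IsClosureUnit s u := by
  have hu0 : u ≠ 0 := by rintro rfl; exact hw (by rw [← h, zero_mul])
  have hv0 : v ≠ 0 := by rintro rfl; exact hw (by rw [← h, mul_zero])
  refine ⟨hu0, hu, ?_⟩
  have : u⁻¹ = v * w⁻¹ := by rw [← h]; field_simp
  rw [this]
  exact mul_mem hv hw'

/-- The unit equation has only finitely many solutions. -/
theorem finite_one_sub (s : Finset ℂ) :
    {x : ℂ | IsClosureUnit s x ∧ IsClosureUnit s (1 - x)}.Finite := by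
  have h := (finite_unit_solutions _ (fg_units_closure s)).image (fun z : ℂˣ × ℂˣ => (z.1 : ℂ))
  refine h.subset ?_
  rintro x ⟨⟨h1, h2, h3⟩, ⟨h4, h5, h6⟩⟩
  refine ⟨(Units.mk0 x h1, Units.mk0 (1 - x) h4), ⟨?_, ?_, ?_⟩, rfl⟩
  · exact (Submonoid.mem_units_iff _ _).2 ⟨h2, by simpa using h3⟩
  · exact (Submonoid.mem_units_iff _ _).2 ⟨h5, by simpa using h6⟩
  · simp

/-- Every unit of a finitely generated subring of `ℂ` becomes a square in a fixed finitely
generated extension. -/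
theorem exists_sq_eq (s : Finset ℂ) : ∃ t : Finset ℂ, s ⊆ t ∧
    ∀ u, IsClosureUnit s u → ∃ w, IsClosureUnit t w ∧ w ^ 2 = u := by
  classical
  obtain ⟨S, hS⟩ := fg_units_closure s
  choose f hf using fun u : ℂ => IsAlgClosed.exists_pow_nat_eq u (n := 2) two_pos
  refine ⟨s ∪ S.image fun g : ℂˣ => f g, Finset.subset_union_left, ?_⟩
  set t := s ∪ S.image fun g : ℂˣ => f g with ht
  have hst : s ⊆ t := Finset.subset_union_left
  have key : ∀ u ∈ Subgroup.closure (S : Set ℂˣ), ∃ w, IsClosureUnit t w ∧ w ^ 2 = (u : ℂ) := by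
    intro u hu
    induction hu using Subgroup.closure_induction with
    | mem g hg =>
      have hgU : IsClosureUnit s g := by
        have : g ∈ (Subring.closure (s : Set ℂ)).toSubmonoid.units := by
          rw [← hS]; exact Subgroup.subset_closure hg
        have h := (Submonoid.mem_units_iff _ _).1 this
        exact ⟨g.ne_zero, h.1, by simpa using h.2⟩
      have hfg : f g ∈ Subring.closure (t : Set ℂ) := Subring.subset_closure
        (Finset.mem_union_right _ (Finset.mem_image_of_mem _ hg))
      exact ⟨f g, of_mul_eq g.ne_zero (by rw [← sq, hf]) hfg hfg (hgU.mono hst).2.2, hf g⟩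
    | one => exact ⟨1, ⟨one_ne_zero, one_mem _, by simp⟩, by simp⟩
    | mul x y _ _ hx hy =>
      obtain ⟨w, hw, hwx⟩ := hx
      obtain ⟨v, hv, hvy⟩ := hy
      exact ⟨w * v, hw.mul hv, by rw [mul_pow, hwx, hvy, Units.val_mul]⟩
    | inv x _ hx =>
      obtain ⟨w, hw, hwx⟩ := hx
      exact ⟨w⁻¹, hw.inv, by rw [inv_pow, hwx, Units.val_inv_eq_inv_val]⟩
  intro u hu
  refine key (Units.mk0 u hu.1) ?_
  rw [hS]
  exact (Submonoid.mem_units_iff _ _).2 ⟨hu.2.1, by simpa using hu.2.2⟩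

end IsClosureUnit

theorem finite_pow_mem {K : Type*} [Field K] {n : ℕ} (hn : 0 < n) {S : Set K} (hS : S.Finite) :
    {x : K | x ^ n ∈ S}.Finite := by
  classical
  refine hS.preimage' (f := fun x : K => x ^ n) fun b _ => ?_
  refine (Polynomial.nthRoots n b).toFinset.finite_toSet.subset fun x hx => ?_
  simpa [Polynomial.mem_nthRoots hn] using hx

section Generic

theorem finite_of_mul_ne_zero (s : Finset ℂ) {d N : ℂ} (τ : ℂ) (hd : d ≠ 0) (hN : N ≠ 0) :
    {t : ℂ × ℂ × ℂ | t.1 ∈ Subring.closure (s : Set ℂ) ∧ t.2.1 ∈ Subring.closure (s : Set ℂ) ∧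
      t.2.2 ∈ Subring.closure (s : Set ℂ) ∧ (t.2.1 * t.2.2) ^ 2 = N ∧
      27 * t.1 ^ 2 * d + 4 * t.2.1 ^ 3 + 4 * t.2.2 ^ 3 * d = τ ∧
      ∀ y z : ℂ, t.2.1 + 3 * d * y ^ 2 = 0 → t.2.2 + 3 * z ^ 2 = 0 →
        3 * t.1 + 2 * (t.2.1 * y + t.2.2 * z) ≠ 0}.Finite := by
  classical
  let s₁ : Finset ℂ := s ∪ {d, d⁻¹, 2⁻¹, 3⁻¹, N⁻¹}
  have hs₁ : s ⊆ s₁ := Finset.subset_union_left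
  have hsub₁ : ∀ x ∈ ({d, d⁻¹, 2⁻¹, 3⁻¹, N⁻¹} : Finset ℂ), x ∈ Subring.closure (s₁ : Set ℂ) :=
    fun x hx => Subring.subset_closure (Finset.mem_union_right _ hx)
  obtain ⟨s₂, hs₂, hsq⟩ := IsClosureUnit.exists_sq_eq s₁
  have hP : {p : ℂ | p ^ 4 ∈ ({N ^ 3 / (81 * d ^ 2)} : Set ℂ)}.Finite :=
    finite_pow_mem (by norm_num) (Set.finite_singleton _)
  let s₃ : Finset ℂ := s₂ ∪ hP.toFinset.image fun p => (τ / (3 * d) - 8 * p)⁻¹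
  have hs₃ : s₂ ⊆ s₃ := Finset.subset_union_left
  have hd₁ : IsClosureUnit s₁ d := ⟨hd, hsub₁ _ (by simp), hsub₁ _ (by simp)⟩
  have h2₁ : IsClosureUnit s₁ 2 := ⟨two_ne_zero, ofNat_mem _ 2,
    hsub₁ _ (by simp)⟩
  have h3₁ : IsClosureUnit s₁ 3 := ⟨three_ne_zero, ofNat_mem _ 3,
    hsub₁ _ (by simp)⟩
  have hA := IsClosureUnit.finite_one_sub s₃
  set A := {x : ℂ | IsClosureUnit s₃ x ∧ IsClosureUnit s₃ (1 - x)} with hAdef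
  have hX : {x : ℂ | x ^ 2 ∈ (fun t : ℂ × ℂ × ℂ => 16 * t.1 * t.2.1 * t.2.2) ''
      (A ×ˢ A ×ˢ {p : ℂ | p ^ 4 ∈ ({N ^ 3 / (81 * d ^ 2)} : Set ℂ)})}.Finite :=
    finite_pow_mem two_pos ((hA.prod (hA.prod hP)).image _)
  set 𝒳 := {x : ℂ | x ^ 2 ∈ (fun t : ℂ × ℂ × ℂ => 16 * t.1 * t.2.1 * t.2.2) ''
      (A ×ˢ A ×ˢ {p : ℂ | p ^ 4 ∈ ({N ^ 3 / (81 * d ^ 2)} : Set ℂ)})} with h𝒳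
  have hW := hX.prod (hA.prod hA)
  refine (((hW.image fun t : ℂ × ℂ × ℂ =>
    (t.1 - 2 * (t.1 / (4 * t.2.2)) - 2 * (t.1 / (4 * t.2.1))) / 3).prod
      ((finite_pow_mem three_pos (hW.image fun t : ℂ × ℂ × ℂ =>
        -3 * d * (t.1 / (4 * t.2.2)) ^ 2)).prod
      (finite_pow_mem three_pos (hW.image fun t : ℂ × ℂ × ℂ =>
        -3 * (t.1 / (4 * t.2.1)) ^ 2)))).subset ?_)
  rintro ⟨a, b, c⟩ ⟨ha, hb, hc, hbc, hτ, hsm⟩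
  dsimp only at ha hb hc hbc hτ hsm
  have hle₁ := Subring.closure_mono (Finset.coe_subset.2 hs₁)
  have hle₃ := Subring.closure_mono (Finset.coe_subset.2 (hs₂.trans hs₃))
  have hbU : IsClosureUnit s₁ b := IsClosureUnit.of_mul_eq (v := b * c ^ 2) hN (by rw [← hbc]; ring)
    (hle₁ hb) (mul_mem (hle₁ hb) (pow_mem (hle₁ hc) 2)) (hsub₁ _ (by simp))
  have hcU : IsClosureUnit s₁ c := IsClosureUnit.of_mul_eq (v := c * b ^ 2) hN (by rw [← hbc]; ring)
    (hle₁ hc) (mul_mem (hle₁ hc) (pow_mem (hle₁ hb) 2)) (hsub₁ _ (by simp))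
  obtain ⟨Y, hY, hY2⟩ := hsq (-(b ^ 3) / (3 * d)) ((hbU.pow 3).neg.div (h3₁.mul hd₁))
  obtain ⟨Z, hZ, hZ2⟩ := hsq (-(c ^ 3) / 3) ((hcU.pow 3).neg.div h3₁)
  replace hY := hY.mono hs₃
  replace hZ := hZ.mono hs₃
  have hb0 := hbU.1
  have hc0 := hcU.1
  have h4 : IsClosureUnit s₃ 4 := by
    have := ((h2₁.mul h2₁).mono hs₂).mono hs₃
    norm_num at this
    exact this
  have hYd : 3 * d * Y ^ 2 = - b ^ 3 := by rw [hY2]; field_simp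
  have hZd : 3 * Z ^ 2 = - c ^ 3 := by rw [hZ2]; field_simp
  have hτ' : τ / (3 * d) = 9 * a ^ 2 - 4 * Y ^ 2 - 4 * Z ^ 2 := by
    rw [div_eq_iff (by simp [hd]), ← hτ]
    linear_combination (4 : ℂ) * hYd + 4 * d * hZd
  have hp : ∀ σ : ℂ, σ ^ 4 = 1 → (σ * (Y * Z)) ^ 4 = N ^ 3 / (81 * d ^ 2) := by
    intro σ hσ
    rw [eq_div_iff (by simp [hd]), ← hbc]
    linear_combination (81 * d ^ 2 * (Y * Z) ^ 4) * hσ +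
      (9 * Z ^ 4 * (3 * d * Y ^ 2 - b ^ 3)) * hYd + (b ^ 6 * (3 * Z ^ 2 - c ^ 3)) * hZd
  have hne : ∀ ε η : ℂ, ε ^ 2 = 1 → η ^ 2 = 1 → 3 * a + 2 * (ε * Y + η * Z) ≠ 0 := by
    intro ε η hε hη
    have := hsm (ε * Y / b) (η * Z / c)
      (by
        field_simp
        linear_combination (3 * d * Y ^ 2) * hε + hYd)
      (by
        field_simp
        linear_combination (3 * Z ^ 2) * hη + hZd)
    rwa [mul_div_cancel₀ _ hb0, mul_div_cancel₀ _ hc0] at this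
  have h2mem : (2 : ℂ) ∈ Subring.closure (s₃ : Set ℂ) := ofNat_mem _ 2
  have h3mem : (3 : ℂ) ∈ Subring.closure (s₃ : Set ℂ) := ofNat_mem _ 3
  have hmem : ∀ ε η : ℂ, (ε = 1 ∨ ε = -1) → (η = 1 ∨ η = -1) →
      3 * a + 2 * (ε * Y + η * Z) ∈ Subring.closure (s₃ : Set ℂ) := by
    intro ε η hε hη
    refine add_mem (mul_mem h3mem (hle₃ (hle₁ ha))) (mul_mem h2mem (add_mem (mul_mem ?_ hY.2.1)
      (mul_mem ?_ hZ.2.1)))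
    · rcases hε with rfl | rfl
      · exact one_mem _
      · exact neg_mem (one_mem _)
    · rcases hη with rfl | rfl
      · exact one_mem _
      · exact neg_mem (one_mem _)
  have hXU : ∀ ε η : ℂ, (ε = 1 ∨ ε = -1) → (η = 1 ∨ η = -1) →
      IsClosureUnit s₃ (3 * a + 2 * (ε * Y + η * Z)) := by
    intro ε η hε hη
    have hε2 : ε ^ 2 = 1 := by rcases hε with rfl | rfl <;> norm_num
    have hη2 : η ^ 2 = 1 := by rcases hη with rfl | rfl <;> norm_num
    have hprod : (3 * a + 2 * (ε * Y + η * Z)) * (3 * a + 2 * (-ε * Y + -η * Z)) =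
        τ / (3 * d) - 8 * (ε * η * (Y * Z)) := by
      rw [hτ']
      linear_combination (-4 * Y ^ 2) * hε2 - (4 * Z ^ 2) * hη2
    refine IsClosureUnit.of_mul_eq ?_ hprod (hmem ε η hε hη) (hmem (-ε) (-η) ?_ ?_) ?_
    · rw [← hprod]
      exact mul_ne_zero (hne ε η hε2 hη2) (hne (-ε) (-η) (by rw [neg_sq, hε2]) (by rw [neg_sq, hη2]))
    · rcases hε with rfl | rfl <;> simp
    · rcases hη with rfl | rfl <;> simp
    · refine Subring.subset_closure (Finset.mem_union_right _ (Finset.mem_image_of_mem _ ?_))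
      rw [Set.Finite.mem_toFinset]
      refine hp _ ?_
      rw [mul_pow, show ε ^ 4 = (ε ^ 2) ^ 2 by ring, show η ^ 4 = (η ^ 2) ^ 2 by ring, hε2, hη2]
      norm_num
  set X₁ := 3 * a + 2 * (1 * Y + 1 * Z) with hX₁
  have hX₁U : IsClosureUnit s₃ X₁ := hXU 1 1 (Or.inl rfl) (Or.inl rfl)
  have hY0 := hY.1
  have hZ0 := hZ.1
  have hX0 := hX₁U.1
  have hα : X₁ / (4 * Z) ∈ A := by
    refine ⟨hX₁U.div (h4.mul hZ), ?_⟩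
    have : 1 - X₁ / (4 * Z) = -((3 * a + 2 * (1 * Y + -1 * Z)) / (4 * Z)) := by
      field_simp
      rw [hX₁]; ring
    rw [this]
    exact ((hXU 1 (-1) (Or.inl rfl) (Or.inr rfl)).div (h4.mul hZ)).neg
  have hβ : X₁ / (4 * Y) ∈ A := by
    refine ⟨hX₁U.div (h4.mul hY), ?_⟩
    have : 1 - X₁ / (4 * Y) = -((3 * a + 2 * (-1 * Y + 1 * Z)) / (4 * Y)) := by
      field_simp
      rw [hX₁]; ring
    rw [this]
    exact ((hXU (-1) 1 (Or.inr rfl) (Or.inl rfl)).div (h4.mul hY)).neg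
  have hX₁X : X₁ ∈ 𝒳 := by
    refine ⟨(X₁ / (4 * Z), X₁ / (4 * Y), Y * Z), ⟨hα, hβ, ?_⟩, ?_⟩
    · have := hp 1 (by norm_num)
      rwa [one_mul] at this
    · dsimp only
      field_simp
      norm_num
  have hmemW : (X₁, X₁ / (4 * Z), X₁ / (4 * Y)) ∈ 𝒳 ×ˢ (A ×ˢ A) := ⟨hX₁X, hα, hβ⟩
  have hYe : X₁ / (4 * (X₁ / (4 * Y))) = Y := by field_simp
  have hZe : X₁ / (4 * (X₁ / (4 * Z))) = Z := by field_simp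
  refine ⟨⟨_, hmemW, ?_⟩, ⟨_, hmemW, ?_⟩, ⟨_, hmemW, ?_⟩⟩
  · dsimp only
    rw [hYe, hZe, hX₁]
    ring
  · dsimp only
    rw [hYe]
    linear_combination -hYd
  · dsimp only
    rw [hZe]
    linear_combination -hZd

end Generic

section Fermat

theorem exists_primitive_cube_root : ∃ ω : ℂ, ω ^ 2 + ω + 1 = 0 := by
  obtain ⟨w, hw⟩ := IsAlgClosed.exists_pow_nat_eq (-3 : ℂ) two_pos
  exact ⟨(-1 + w) / 2, by linear_combination (1 / 4) * hw⟩

/-- A binary cubic form `a x³ + b x² y + d y³` with nonzero discriminant is a sum of two cubes of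
linear forms. -/
theorem exists_sum_two_cubes {a b d : ℂ} (hd : d ≠ 0) (hdisc : 27 * a ^ 2 * d + 4 * b ^ 3 ≠ 0) :
    ∃ r₁ p₁ r₂ p₂ : ℂ, r₁ * p₂ - r₂ * p₁ ≠ 0 ∧
      ∀ x y : ℂ, (r₁ * x + p₁ * y) ^ 3 + (r₂ * x + p₂ * y) ^ 3 =
        a * x ^ 3 + b * x ^ 2 * y + d * y ^ 3 := by
  obtain ⟨κ, hκ⟩ := IsAlgClosed.exists_pow_nat_eq
    ((27 * a ^ 2 * d + 4 * b ^ 3) / (27 * d ^ 5)) (n := 6) (by norm_num)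
  have hκ0 : κ ≠ 0 := by
    rintro rfl
    refine div_ne_zero hdisc (by simp [hd]) (hκ.symm.trans (by norm_num))
  have hκ' : 27 * d ^ 5 * κ ^ 6 = 27 * a ^ 2 * d + 4 * b ^ 3 := by
    rw [hκ]; field_simp
  have hex : ∃ p₁ p₂ : ℂ, p₁ ^ 3 = (d - a / (κ ^ 3 * d)) / 2 ∧
      p₂ ^ 3 = (d + a / (κ ^ 3 * d)) / 2 ∧ 3 * κ ^ 2 * d * (p₁ * p₂) = b := by
    obtain ⟨p₁, hp₁⟩ := IsAlgClosed.exists_pow_nat_eq ((d - a / (κ ^ 3 * d)) / 2) three_pos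
    by_cases h0 : p₁ = 0
    · obtain ⟨p₂, hp₂⟩ := IsAlgClosed.exists_pow_nat_eq ((d + a / (κ ^ 3 * d)) / 2) three_pos
      refine ⟨p₁, p₂, hp₁, hp₂, ?_⟩
      subst h0
      have ha : a = κ ^ 3 * d ^ 2 := by
        field_simp at hp₁
        linear_combination hp₁
      have hb : b ^ 3 = 0 := by
        rw [ha] at hκ'
        linear_combination (-1 / 4 : ℂ) * hκ'
      rw [pow_eq_zero_iff (by norm_num)] at hb
      rw [hb]; ring
    · refine ⟨p₁, b / (3 * κ ^ 2 * d * p₁), hp₁, ?_, by field_simp⟩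
      rw [div_pow, mul_pow, hp₁, div_eq_iff (by rw [← hp₁]; simp [hκ0, hd, h0])]
      field_simp
      linear_combination (-1 : ℂ) * hκ'
  obtain ⟨p₁, p₂, hp₁, hp₂, hp⟩ := hex
  have hsum : p₁ ^ 3 + p₂ ^ 3 = d := by rw [hp₁, hp₂]; ring
  have hsub : κ ^ 3 * d * (p₂ ^ 3 - p₁ ^ 3) = a := by
    rw [hp₁, hp₂]; field_simp; ring
  refine ⟨κ * p₂ ^ 2, p₁, -κ * p₁ ^ 2, p₂, ?_, fun x y => ?_⟩
  · have : κ * p₂ ^ 2 * p₂ - -κ * p₁ ^ 2 * p₁ = κ * d := by rw [← hsum]; ring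
    rw [this]
    exact mul_ne_zero hκ0 hd
  · linear_combination x ^ 3 * hsub + x ^ 2 * y * hp + y ^ 3 * hsum +
      κ ^ 3 * x ^ 3 * (p₂ ^ 3 - p₁ ^ 3) * hsum + 3 * κ ^ 2 * x ^ 2 * y * p₁ * p₂ * hsum

/-- Only finitely many binary cubics `a x³ + b x² y + d y³` are sums of two cubes of linear forms
with coefficients in a fixed finitely generated ring and determinant in a fixed finite set. -/
theorem finite_sum_two_cubes (s : Finset ℂ) {d e : ℂ} (δ : ℂ) (hd : d ≠ 0) (he : e ≠ 0) :
    {t : ℂ × ℂ | ∃ r₁ p₁ r₂ p₂ q : ℂ, p₁ ∈ Subring.closure (s : Set ℂ) ∧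
      p₂ ∈ Subring.closure (s : Set ℂ) ∧ p₁ ^ 3 + p₂ ^ 3 = d ∧
      r₁ * p₁ ^ 2 + r₂ * p₂ ^ 2 = 0 ∧ q ^ 3 = e ∧ q * (r₁ * p₂ - r₂ * p₁) = δ ∧
      t.1 = r₁ ^ 3 + r₂ ^ 3 ∧ t.2 = 3 * (r₁ ^ 2 * p₁ + r₂ ^ 2 * p₂)}.Finite := by
  classical
  obtain ⟨ω, hω⟩ := exists_primitive_cube_root
  have hω3 : ω ^ 3 = 1 := by linear_combination (ω - 1) * hω
  have hω0 : ω ≠ 0 := by rintro rfl; norm_num at hω3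
  have hω1 : 1 - ω ≠ 0 := by
    intro h
    have : ω = 1 := (sub_eq_zero.1 h).symm
    rw [this] at hω
    norm_num at hω
  let t : Finset ℂ := s ∪ {ω, d⁻¹}
  have hle := Subring.closure_mono (Finset.coe_subset.2 (Finset.subset_union_left : s ⊆ t))
  have hωt : ω ∈ Subring.closure (t : Set ℂ) := Subring.subset_closure (by simp [t])
  have hdt : d⁻¹ ∈ Subring.closure (t : Set ℂ) := Subring.subset_closure (by simp [t])
  have hA := IsClosureUnit.finite_one_sub t
  set A := {x : ℂ | IsClosureUnit t x ∧ IsClosureUnit t (1 - x)} with hAdef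
  have hM := finite_pow_mem three_pos (hA.image fun α => d / (α * (1 - α)))
  have hQ := finite_pow_mem three_pos (Set.finite_singleton e)
  let P₂ : ℂ × ℂ × ℂ → ℂ := fun u => (u.1 + ω ^ 2 * u.2.1 * u.1) / (1 - ω)
  let P₁ : ℂ × ℂ × ℂ → ℂ := fun u => u.1 - P₂ u
  let R₁ : ℂ × ℂ × ℂ → ℂ := fun u => δ / u.2.2 * P₂ u ^ 2 / d
  let R₂ : ℂ × ℂ × ℂ → ℂ := fun u => -(δ / u.2.2) * P₁ u ^ 2 / d
  refine ((hM.prod (hA.prod hQ)).image fun u =>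
    (R₁ u ^ 3 + R₂ u ^ 3, 3 * (R₁ u ^ 2 * P₁ u + R₂ u ^ 2 * P₂ u))).subset ?_
  rintro ⟨a, b⟩ ⟨r₁, p₁, r₂, p₂, q, hp₁, hp₂, hsum, hr, hq, hδ, ha, hb⟩
  dsimp only at ha hb
  replace hp₁ := hle hp₁
  replace hp₂ := hle hp₂
  have hq0 : q ≠ 0 := by rintro rfl; exact he (by rw [← hq]; norm_num)
  have m0 : p₁ + p₂ ∈ Subring.closure (t : Set ℂ) := add_mem hp₁ hp₂
  have m1 : p₁ + ω * p₂ ∈ Subring.closure (t : Set ℂ) := add_mem hp₁ (mul_mem hωt hp₂)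
  have m2 : p₁ + ω ^ 2 * p₂ ∈ Subring.closure (t : Set ℂ) :=
    add_mem hp₁ (mul_mem (pow_mem hωt 2) hp₂)
  have hprod : (p₁ + p₂) * (p₁ + ω * p₂) * (p₁ + ω ^ 2 * p₂) = d := by
    rw [← hsum]
    linear_combination (p₁ ^ 2 * p₂ + ω * p₁ * p₂ ^ 2) * hω + p₂ ^ 3 * hω3
  have u0 : IsClosureUnit t (p₁ + p₂) := IsClosureUnit.of_mul_eq hd
    (v := (p₁ + ω * p₂) * (p₁ + ω ^ 2 * p₂)) (by rw [← hprod]; ring) m0 (mul_mem m1 m2) hdt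
  have u1 : IsClosureUnit t (p₁ + ω * p₂) := IsClosureUnit.of_mul_eq hd
    (v := (p₁ + p₂) * (p₁ + ω ^ 2 * p₂)) (by rw [← hprod]; ring) m1 (mul_mem m0 m2) hdt
  have u2 : IsClosureUnit t (p₁ + ω ^ 2 * p₂) := IsClosureUnit.of_mul_eq hd
    (v := (p₁ + p₂) * (p₁ + ω * p₂)) (by rw [← hprod]; ring) m2 (mul_mem m0 m1) hdt
  have uω : IsClosureUnit t ω := IsClosureUnit.of_mul_eq one_ne_zero (v := ω ^ 2)
    (by linear_combination hω3) hωt (pow_mem hωt 2) (by simp)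
  have h0 := u0.1
  have h1 := u1.1
  have h2 := u2.1
  set α := -(ω * ((p₁ + ω * p₂) / (p₁ + p₂))) with hα
  have hα' : 1 - α = -(-(ω ^ 2 * ((p₁ + ω ^ 2 * p₂) / (p₁ + p₂)))) * (-1) := by
    rw [hα]
    field_simp
    linear_combination (p₁ + (ω ^ 2 - ω + 1) * p₂) * hω
  have hαA : α ∈ A := by
    refine ⟨(uω.mul (u1.div u0)).neg, ?_⟩
    rw [hα', mul_neg_one]
    exact (((uω.pow 2).mul (u2.div u0)).neg).neg.neg
  have hμ1 : ω ^ 2 * α * (p₁ + p₂) = -(p₁ + ω * p₂) := by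
    rw [hα]
    field_simp
    linear_combination -hω3
  have hcube : (p₁ + p₂) ^ 3 = d / (α * (1 - α)) := by
    rw [eq_div_iff (mul_ne_zero hαA.1.1 hαA.2.1), hα', hα, ← hprod]
    field_simp
    linear_combination ((p₁ + ω * p₂) * (p₁ + ω ^ 2 * p₂)) * hω3
  have hP2 : P₂ (p₁ + p₂, α, q) = p₂ := by
    simp only [P₂]
    rw [hμ1, div_eq_iff hω1]
    ring
  have hP1 : P₁ (p₁ + p₂, α, q) = p₁ := by simp only [P₁]; rw [hP2]; ring
  have hD : δ / q = r₁ * p₂ - r₂ * p₁ := by rw [← hδ]; field_simp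
  have hR1 : R₁ (p₁ + p₂, α, q) = r₁ := by
    simp only [R₁]
    rw [hP2, hD, div_eq_iff hd, ← hsum]
    linear_combination -p₁ * hr
  have hR2 : R₂ (p₁ + p₂, α, q) = r₂ := by
    simp only [R₂]
    rw [hP1, hD, div_eq_iff hd, ← hsum]
    linear_combination -p₂ * hr
  refine ⟨(p₁ + p₂, α, q), ⟨⟨α, hαA, hcube.symm⟩, hαA, hq⟩, ?_⟩
  dsimp only
  rw [hR1, hR2, hP1, hP2, ha, hb]

/-- If a sum of three cubes of independent linear forms in `x, y, z` equals
`a x³ + b x² y + d y³ + e z³`, then one of the linear forms is a multiple of `z` and the others do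
not involve `z`. -/
theorem exists_split_of_sum_three_cubes {N : Matrix (Fin 3) (Fin 3) ℂ} (hN : N.det ≠ 0)
    {a b d e : ℂ} (he : e ≠ 0)
    (h : ∀ x y z : ℂ, ∑ i, (N i 0 * x + N i 1 * y + N i 2 * z) ^ 3 =
      a * x ^ 3 + b * x ^ 2 * y + d * y ^ 3 + e * z ^ 3) :
    ∃ i j k : Fin 3, N i 1 ^ 3 + N j 1 ^ 3 = d ∧ N i 0 * N i 1 ^ 2 + N j 0 * N j 1 ^ 2 = 0 ∧
      N k 2 ^ 3 = e ∧ N k 2 * (N i 0 * N j 1 - N j 0 * N i 1) = N.det ∧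
      a = N i 0 ^ 3 + N j 0 ^ 3 ∧ b = 3 * (N i 0 ^ 2 * N i 1 + N j 0 ^ 2 * N j 1) := by
  simp only [Fin.sum_univ_three] at h
  have e1 := h 1 0 0
  have e2 := h 0 1 0
  have e3 := h 0 0 1
  have e4 := h 1 1 0
  have e5 := h 1 (-1) 0
  have e6 := h 1 0 1
  have e7 := h 1 0 (-1)
  have e8 := h 0 1 1
  have e9 := h 0 1 (-1)
  have e10 := h 1 1 1
  simp only [mul_zero, mul_one, mul_neg, add_zero, zero_add] at e1 e2 e3 e4 e5 e6 e7 e8 e9 e10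
  have c1 : N 0 0 ^ 3 + N 1 0 ^ 3 + N 2 0 ^ 3 = a := by linear_combination e1
  have c2 : N 0 1 ^ 3 + N 1 1 ^ 3 + N 2 1 ^ 3 = d := by linear_combination e2
  have c3 : N 0 2 ^ 3 + N 1 2 ^ 3 + N 2 2 ^ 3 = e := by linear_combination e3
  have c4 : 3 * (N 0 0 ^ 2 * N 0 1 + N 1 0 ^ 2 * N 1 1 + N 2 0 ^ 2 * N 2 1) = b := by
    linear_combination (1 / 2) * e4 - (1 / 2) * e5 - e2
  have c5 : N 0 0 * N 0 1 ^ 2 + N 1 0 * N 1 1 ^ 2 + N 2 0 * N 2 1 ^ 2 = 0 := by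
    linear_combination (1 / 6) * e4 + (1 / 6) * e5 - (1 / 3) * e1
  have c6 : N 0 2 * N 0 0 * N 0 0 + N 1 2 * N 1 0 * N 1 0 + N 2 2 * N 2 0 * N 2 0 = 0 := by
    linear_combination (1 / 6) * e6 - (1 / 6) * e7 - (1 / 3) * e3
  have c7 : N 0 2 * N 0 0 * N 0 2 + N 1 2 * N 1 0 * N 1 2 + N 2 2 * N 2 0 * N 2 2 = 0 := by
    linear_combination (1 / 6) * e6 + (1 / 6) * e7 - (1 / 3) * e1
  have c8 : N 0 2 * N 0 1 * N 0 1 + N 1 2 * N 1 1 * N 1 1 + N 2 2 * N 2 1 * N 2 1 = 0 := by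
    linear_combination (1 / 6) * e8 - (1 / 6) * e9 - (1 / 3) * e3
  have c9 : N 0 2 * N 0 1 * N 0 2 + N 1 2 * N 1 1 * N 1 2 + N 2 2 * N 2 1 * N 2 2 = 0 := by
    linear_combination (1 / 6) * e8 + (1 / 6) * e9 - (1 / 3) * e2
  have c10 : N 0 2 * N 0 0 * N 0 1 + N 1 2 * N 1 0 * N 1 1 + N 2 2 * N 2 0 * N 2 1 = 0 := by
    linear_combination (1 / 6) * e10 - (1 / 6) * c1 - (1 / 6) * c2 - (1 / 6) * c3 -
      (1 / 6) * c4 - (1 / 2) * (c5 + c6 + c7 + c8 + c9)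
  have hv0 : (fun i => N i 2 * N i 0) = 0 := Matrix.eq_zero_of_vecMul_eq_zero hN <| by
    ext j
    fin_cases j <;> simp only [Matrix.vecMul, dotProduct, Fin.sum_univ_three, Fin.zero_eta,
      Fin.mk_one, Fin.reduceFinMk, Pi.zero_apply] <;> assumption
  have hv1 : (fun i => N i 2 * N i 1) = 0 := Matrix.eq_zero_of_vecMul_eq_zero hN <| by
    ext j
    fin_cases j <;> simp only [Matrix.vecMul, dotProduct, Fin.sum_univ_three, Fin.zero_eta,
      Fin.mk_one, Fin.reduceFinMk, Pi.zero_apply]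
    · linear_combination c10
    · exact c8
    · exact c9
  have hrow (k : Fin 3) (hk : N k 2 ≠ 0) : N k 0 = 0 ∧ N k 1 = 0 :=
    ⟨(mul_eq_zero.1 (congrFun hv0 k)).resolve_left hk,
      (mul_eq_zero.1 (congrFun hv1 k)).resolve_left hk⟩
  have huniq (j k : Fin 3) (hjk : j ≠ k) (hk : N k 2 ≠ 0) : N j 2 = 0 := by
    by_contra hj
    have hvec : N j 2 • N k - N k 2 • N j = 0 := by
      ext l
      fin_cases l <;> simp [hrow j hj, hrow k hk, mul_comm]
    have := Matrix.eq_zero_of_vecMul_eq_zero hN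
      (v := N j 2 • Pi.single k 1 - N k 2 • Pi.single j 1)
      (by rw [Matrix.sub_vecMul, Matrix.smul_vecMul, Matrix.smul_vecMul, Matrix.single_one_vecMul,
        Matrix.single_one_vecMul]; exact hvec)
    have := congrFun this k
    simp [hjk.symm, hj] at this
  have key : ∃ k, N k 2 ≠ 0 := by
    by_contra! h0
    apply he
    rw [← c3, h0, h0, h0]
    norm_num
  obtain ⟨k, hk⟩ := key
  obtain ⟨hk0, hk1⟩ := hrow k hk
  rw [Matrix.det_fin_three]
  fin_cases k <;> simp only [Fin.zero_eta, Fin.mk_one, Fin.reduceFinMk] at hk hk0 hk1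
  · have hj1 := huniq 1 0 (by decide) hk
    have hj2 := huniq 2 0 (by decide) hk
    refine ⟨1, 2, 0, ?_, ?_, ?_, ?_, ?_, ?_⟩ <;>
      simp only [hk0, hk1, hj1, hj2] at * <;> grind
  · have hj1 := huniq 0 1 (by decide) hk
    have hj2 := huniq 2 1 (by decide) hk
    refine ⟨2, 0, 1, ?_, ?_, ?_, ?_, ?_, ?_⟩ <;>
      simp only [hk0, hk1, hj1, hj2] at * <;> grind
  · have hj1 := huniq 0 2 (by decide) hk
    have hj2 := huniq 1 2 (by decide) hk
    refine ⟨0, 1, 2, ?_, ?_, ?_, ?_, ?_, ?_⟩ <;>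
      simp only [hk0, hk1, hj1, hj2] at * <;> grind

end Fermat

section Degenerate

variable {a b c d : ℂ}

theorem smoothHyp.eq_zero_of_cubicNF (h : smoothHyp (cubicNF a b c d)) {x y z : ℂ}
    (h0 : 3 * a * x ^ 2 + 2 * x * (b * y + c * z) = 0) (h1 : b * x ^ 2 + 3 * d * y ^ 2 = 0)
    (h2 : c * x ^ 2 + 3 * z ^ 2 = 0) : x = 0 ∧ y = 0 ∧ z = 0 := by
  obtain ⟨p0, p1, p2⟩ := pderiv_cubicNF (a := a) (b := b) (c := c) (d := d)
  have := h ![x, y, z] fun i => by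
    fin_cases i
    · simp only [Fin.zero_eta, p0]
      simp
      linear_combination h0
    · simp only [Fin.mk_one, p1]
      simp
      linear_combination h1
    · simp only [Fin.reduceFinMk, p2]
      simp
      linear_combination h2
  exact ⟨congrFun this 0, congrFun this 1, congrFun this 2⟩

theorem smoothHyp.not_all_zero (h : smoothHyp (cubicNF a b c d)) :
    ¬ (a = 0 ∧ b = 0 ∧ c = 0) := by
  rintro ⟨rfl, rfl, rfl⟩
  have := (h.eq_zero_of_cubicNF (x := 1) (y := 0) (z := 0) (by simp) (by simp) (by simp)).1
  norm_num at this

/-- A smooth cubic `a x³ + x² (b y + c z) + d y³ + z³` with `b c = 0` is a sum of three cubes of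
independent linear forms. -/
theorem exists_sum_three_cubes (hd : d ≠ 0) (h : smoothHyp (cubicNF a b c d)) (hbc : b * c = 0) :
    ∃ L : Matrix (Fin 3) (Fin 3) ℂ, L.det ≠ 0 ∧
      ∀ x, ∑ i, L.mulVec x i ^ 3 = eval x (cubicNF a b c d) := by
  rcases mul_eq_zero.1 hbc with rfl | rfl
  · have hdisc : 27 * a ^ 2 * 1 + 4 * c ^ 3 ≠ 0 := by
      intro h0
      by_cases hc : c = 0
      · subst hc
        have ha : a = 0 := by simpa using h0
        exact h.not_all_zero ⟨ha, rfl, rfl⟩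
      · have := (h.eq_zero_of_cubicNF (x := 2 * c) (y := 0) (z := -3 * a) (by ring) (by ring)
          (by linear_combination h0)).1
        exact hc (by simpa using this)
    obtain ⟨r₁, p₁, r₂, p₂, hdet, hs⟩ := exists_sum_two_cubes one_ne_zero hdisc
    obtain ⟨q, hq⟩ := IsAlgClosed.exists_pow_nat_eq d three_pos
    have hq0 : q ≠ 0 := by rintro rfl; exact hd (by rw [← hq]; norm_num)
    refine ⟨!![r₁, 0, p₁; r₂, 0, p₂; 0, q, 0], ?_, fun x => ?_⟩
    · rw [Matrix.det_fin_three]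
      simp
      grind
    · have := hs (x 0) (x 2)
      rw [eval_cubicNF]
      simp [Fin.sum_univ_three, Matrix.mulVec, dotProduct]
      linear_combination this + x 1 ^ 3 * hq
  · have hdisc : 27 * a ^ 2 * d + 4 * b ^ 3 ≠ 0 := by
      intro h0
      by_cases hb : b = 0
      · subst hb
        have ha : a = 0 := by simpa [hd] using h0
        exact h.not_all_zero ⟨ha, rfl, rfl⟩
      · have := (h.eq_zero_of_cubicNF (x := 2 * b) (y := -3 * a) (z := 0) (by ring)
          (by linear_combination h0) (by ring)).1
        exact hb (by simpa using this)
    obtain ⟨r₁, p₁, r₂, p₂, hdet, hs⟩ := exists_sum_two_cubes hd hdisc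
    refine ⟨!![r₁, p₁, 0; r₂, p₂, 0; 0, 0, 1], ?_, fun x => ?_⟩
    · rw [Matrix.det_fin_three]
      simp
      grind
    · have := hs (x 0) (x 1)
      rw [eval_cubicNF]
      simp [Fin.sum_univ_three, Matrix.mulVec, dotProduct]
      linear_combination this

/-- Only finitely many cubics `a x³ + b x² y + d y³ + e z³` are sums of three cubes of linear forms
with coefficients in a fixed finitely generated ring and a fixed nonzero determinant. -/
theorem finite_sum_three_cubes (s : Finset ℂ) {d e δ : ℂ} (hd : d ≠ 0) (he : e ≠ 0) (hδ : δ ≠ 0) :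
    {t : ℂ × ℂ | ∃ N : Matrix (Fin 3) (Fin 3) ℂ, (∀ i j, N i j ∈ Subring.closure (s : Set ℂ)) ∧
      N.det = δ ∧ ∀ x y z : ℂ, ∑ i, (N i 0 * x + N i 1 * y + N i 2 * z) ^ 3 =
        t.1 * x ^ 3 + t.2 * x ^ 2 * y + d * y ^ 3 + e * z ^ 3}.Finite := by
  refine (finite_sum_two_cubes s δ hd he).subset ?_
  rintro ⟨a, b⟩ ⟨N, hmem, hdet, h⟩
  obtain ⟨i, j, k, h1, h2, h3, h4, h5, h6⟩ :=
    exists_split_of_sum_three_cubes (hdet.trans_ne hδ) he h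
  exact ⟨N i 0, N i 1, N j 0, N j 1, N k 2, hmem i 1, hmem j 1, h1, h2, h3, h4.trans hdet, h5, h6⟩

theorem finite_of_mul_eq_zero (s : Finset ℂ) {L : Matrix (Fin 3) (Fin 3) ℂ} (hL : L.det ≠ 0)
    (hd : d ≠ 0) :
    {t : ℂ × ℂ × ℂ | t.2.1 * t.2.2 = 0 ∧ ∃ M : Matrix (Fin 3) (Fin 3) ℂ,
      (∀ i j, M i j ∈ Subring.closure (s : Set ℂ)) ∧ M.det = 1 ∧
      ∀ x, ∑ i, (L * M).mulVec x i ^ 3 = eval x (cubicNF t.1 t.2.1 t.2.2 d)}.Finite := by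
  classical
  let s' : Finset ℂ := s ∪ Finset.univ.image fun p : Fin 3 × Fin 3 => L p.1 p.2
  have hs := Subring.closure_mono (Finset.coe_subset.2 (Finset.subset_union_left : s ⊆ s'))
  have hLs (i j) : L i j ∈ Subring.closure (s' : Set ℂ) := Subring.subset_closure <|
    Finset.mem_coe.2 <| Finset.mem_union_right _ <|
      Finset.mem_image.2 ⟨(i, j), Finset.mem_univ _, rfl⟩
  have f1 := (finite_sum_three_cubes s' hd one_ne_zero hL).image
    fun t : ℂ × ℂ => (t.1, t.2, (0 : ℂ))
  have f2 := (finite_sum_three_cubes s' one_ne_zero hd (neg_ne_zero.2 hL)).image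
    fun t : ℂ × ℂ => (t.1, (0 : ℂ), t.2)
  refine (f1.union f2).subset ?_
  rintro ⟨a, b, c⟩ ⟨hbc, M, hM, hdet, h⟩
  have hmem (i j) : (L * M) i j ∈ Subring.closure (s' : Set ℂ) := by
    rw [Matrix.mul_apply]
    exact sum_mem fun k _ => mul_mem (hLs i k) (hs (hM k j))
  have hN : (L * M).det = L.det := by rw [Matrix.det_mul, hdet, mul_one]
  generalize L * M = N at *
  have hx (x y z : ℂ) := h ![x, y, z]
  simp only [eval_cubicNF, Matrix.mulVec, dotProduct, Fin.sum_univ_three] at hx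
  simp at hx
  dsimp only at hbc
  rcases mul_eq_zero.1 hbc with rfl | rfl
  · refine Or.inr ⟨(a, c), ⟨N.submatrix id (Equiv.swap 1 2), fun i j => hmem _ _, ?_,
      fun x y z => ?_⟩, rfl⟩
    · rw [Matrix.det_permute', hN]
      simp
    · rw [Fin.sum_univ_three]
      have s0 : Equiv.swap (1 : Fin 3) 2 0 = 0 := by decide
      have s1 : Equiv.swap (1 : Fin 3) 2 1 = 2 := by decide
      have s2 : Equiv.swap (1 : Fin 3) 2 2 = 1 := by decide
      simp only [Matrix.submatrix_apply, id, s0, s1, s2]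
      linear_combination hx x z y
  · refine Or.inl ⟨(a, b), ⟨N, hmem, hN, fun x y z => ?_⟩, rfl⟩
    rw [Fin.sum_univ_three]
    linear_combination hx x y z

end Degenerate

/-- Proposition 3.14. Let `R ⊆ ℂ` be a subring finitely
generated over ℤ, `F ∈ R[x,y,z]` a cubic form with `{F = 0} ⊆ ℙ²(ℂ)` smooth,
and `G = d·y³ + z³` with `d ≠ 0`. If `F` admits a reduced form with third entry
`G`, then the set of pairs `(a', (b', c')) ∈ R × R²` arising in such reduced
forms is finite. -/
theorem stmt8 (R : Subring ℂ) (hfg : ∃ s : Finset ℂ, R = Subring.closure ↑s)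
    (F : MvPolynomial (Fin 3) R) (hF3 : F.IsHomogeneous 3)
    (hsm : smoothHyp (F.map R.subtype))
    (d : R) (hd : d ≠ 0)
    (hred : ∃ (a b c : R) (T₀ : Matrix (Fin 3) (Fin 3) R), T₀.det = 1 ∧
      matAct T₀ F = C a * X 0 ^ 3 + X 0 ^ 2 * (C b * X 1 + C c * X 2) +
        (C d * X 1 ^ 3 + X 2 ^ 3)) :
    {q : R × R × R | ∃ T : Matrix (Fin 3) (Fin 3) R, T.det = 1 ∧
      matAct T F = C q.1 * X 0 ^ 3 + X 0 ^ 2 * (C q.2.1 * X 1 + C q.2.2 * X 2) +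
        (C d * X 1 ^ 3 + X 2 ^ 3)}.Finite := by
  obtain ⟨s, hs⟩ := hfg
  obtain ⟨a, b, c, T₀, hT₀, hF₀⟩ := hred
  change matAct T₀ F = cubicNF a b c d at hF₀
  have hmap (a b c : R) : (cubicNF a b c d).map R.subtype = cubicNF (a : ℂ) b c d := by
    simp [cubicNF]
  have hsmooth {a b c : R} {T : Matrix (Fin 3) (Fin 3) R} (hT : T.det = 1)
      (hTF : matAct T F = cubicNF a b c d) : smoothHyp (cubicNF (a : ℂ) b c d) := by
    rw [← hmap, ← hTF, map_matAct]
    refine hsm.matAct ?_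
    rw [← RingHom.mapMatrix_apply, ← RingHom.map_det, hT, map_one]
  have hd' : (d : ℂ) ≠ 0 := by simpa using hd
  have key : ∀ q : R × R × R, (∃ T : Matrix (Fin 3) (Fin 3) R, T.det = 1 ∧
      matAct T F = cubicNF q.1 q.2.1 q.2.2 d) →
      smoothHyp (cubicNF (q.1 : ℂ) q.2.1 q.2.2 d) ∧ ∃ M : Matrix (Fin 3) (Fin 3) ℂ,
        (∀ i j, M i j ∈ R) ∧ M.det = 1 ∧
        matAct M (cubicNF (a : ℂ) b c d) = cubicNF (q.1 : ℂ) q.2.1 q.2.2 d := by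
    rintro q ⟨T, hT, hTF⟩
    refine ⟨hsmooth hT hTF, (T₀.adjugate * T).map R.subtype, fun i j => Subtype.property _, ?_, ?_⟩
    · rw [← RingHom.mapMatrix_apply, ← RingHom.map_det, Matrix.det_mul, Matrix.det_adjugate, hT₀,
        hT, one_pow, one_mul, map_one]
    · rw [← hmap, ← hmap, ← map_matAct, ← hF₀, matAct_matAct, ← Matrix.mul_assoc,
        Matrix.mul_adjugate, hT₀, one_smul, Matrix.one_mul, hTF]
  let ι : R × R × R → ℂ × ℂ × ℂ := fun q => (q.1, q.2.1, q.2.2)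
  have hι : Function.Injective ι := by
    rintro ⟨x, y, z⟩ ⟨x', y', z'⟩ h
    simpa [ι] using h
  have inv := fun q hq =>
    let ⟨hsq, M, _, hM, h⟩ := key q hq
    cubicNF_invariants hd' hM h hsq.not_all_zero
  have hmemR (x : R) : (x : ℂ) ∈ Subring.closure (s : Set ℂ) := hs ▸ x.2
  by_cases hbc : ((b : ℂ) * c) = 0
  · obtain ⟨L, hL, hLsum⟩ := exists_sum_three_cubes hd' (hsmooth hT₀ hF₀) hbc
    refine ((finite_of_mul_eq_zero s hL hd').preimage hι.injOn).subset ?_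
    intro q hq
    obtain ⟨-, M, hMR, hM, h⟩ := key q hq
    refine ⟨?_, M, fun i j => hs ▸ hMR i j, hM, fun x => ?_⟩
    · have := (inv q hq).1
      rw [hbc] at this
      exact pow_eq_zero_iff two_ne_zero |>.1 (this.trans (by norm_num))
    · rw [← h, eval_matAct, ← hLsum, Matrix.mulVec_mulVec]
  · refine ((finite_of_mul_ne_zero s
      (27 * (a : ℂ) ^ 2 * d + 4 * (b : ℂ) ^ 3 + 4 * (c : ℂ) ^ 3 * d) hd' (pow_ne_zero 2 hbc)).preimage hι.injOn).subset ?_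
    intro q hq
    refine ⟨hmemR _, hmemR _, hmemR _, (inv q hq).1, (inv q hq).2, fun y z hy hz h0 => ?_⟩
    have := ((key q hq).1.eq_zero_of_cubicNF (x := 1) (y := y) (z := z)
      (by linear_combination h0) (by linear_combination hy) (by linear_combination hz)).1
    exact one_ne_zero this
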